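/- arXiv:1709.08504 — 8 statements merged into one kernel-verified Lean document; each statement's English description precedes it below -/
import Mathlib

section
/- Let l ≥ 0, m ≥ 2 and n ≥ 1 be integers, and set j = m + n − m⌈n/m⌉ (so 1 ≤ j ≤ m). If 0 ≤ l ≤ (1/(m−1))·(n/m − m), then the number of partitions (k₁,…,k_m) of n into at most m parts with largest part k₁ = ⌈n/m⌉ + l equals |𝒫_{m(l+1)−j}(m−1)|, the number of partitions of m(l+1)−j into at most m−1 parts. -/
open scoped BigOperators

/-- The set of partitions of `N` into at most `k` parts, encoded as weakly decreasing
functions `Fin k → ℕ` summing to `N`. -/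
def restPart (N k : ℕ) : Set (Fin k → ℕ) := {f | Antitone f ∧ ∑ i, f i = N}

/-- The number of partitions of `N` into at most `k` parts. -/
noncomputable def numPart (N k : ℕ) : ℕ := Nat.card (restPart N k)

/-- Subtracting all parts from the largest part `M` turns partitions of `n` into at most `k + 1`
parts with largest part `M` into partitions of `(k + 1) * M - n` into at most `k` parts. -/
theorem card_largest_part_eq_numPart {k M n N : ℕ} (hN : N + n = (k + 1) * M) (hNM : N ≤ M) :
    Nat.card {f : Fin (k + 1) → ℕ // Antitone f ∧ (∑ i, f i) = n ∧ f 0 = M} = numPart N k := by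
  have sum_compl (u : Fin k → ℕ) (hu : ∀ i, u i ≤ M) :
      ∑ i : Fin k, (M - u i.rev) + ∑ i, u i = k * M := by
    rw [← Equiv.sum_comp Fin.revPerm u, ← Finset.sum_add_distrib]
    simp [Nat.sub_add_cancel (hu _)]
  have le_of_mem {g : Fin k → ℕ} (hg : g ∈ restPart N k) (i : Fin k) : g i ≤ M :=
    (Finset.single_le_sum (fun _ _ => Nat.zero_le _) (Finset.mem_univ i)).trans (hg.2.trans_le hNM)
  refine Nat.card_congr
    { toFun := fun f => ⟨fun i => M - f.1 i.rev.succ, ?_, ?_⟩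
      invFun := fun g => ⟨Fin.cons M fun i => M - g.1 i.rev, ?_, ?_, rfl⟩
      left_inv := ?_
      right_inv := ?_ }
  · intro a b hab
    exact Nat.sub_le_sub_left (f.2.1 (Fin.succ_le_succ_iff.2 (Fin.rev_le_rev.2 hab))) M
  · obtain ⟨f, hf, hs, h0⟩ := f
    have := sum_compl (fun i => f i.succ) fun i => h0 ▸ hf (Fin.zero_le _)
    rw [Fin.sum_univ_succ] at hs
    dsimp only at *
    linarith
  · intro a b hab
    cases b using Fin.cases with
    | zero => rw [Fin.le_zero_iff.1 hab]
    | succ b =>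
      cases a using Fin.cases with
      | zero => simp
      | succ a =>
        exact Nat.sub_le_sub_left (g.2.1 (Fin.rev_le_rev.2 (Fin.succ_le_succ_iff.1 hab))) M
  · have := sum_compl g.1 (le_of_mem g.2)
    have hs := g.2.2
    rw [Fin.sum_univ_succ]
    simp only [Fin.cons_zero, Fin.cons_succ]
    linarith
  · rintro ⟨f, hf, hs, h0⟩
    ext i
    cases i using Fin.cases with
    | zero => simp [h0]
    | succ i =>
      have : f i.succ ≤ M := h0 ▸ hf (Fin.zero_le _)
      simp [Nat.sub_sub_self this]
  · intro g
    ext i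
    simp [Nat.sub_sub_self (le_of_mem g.2 i)]

/-- If `0 ≤ l ≤ (1/(m-1))(n/m - m)` and `j = m + n - m⌈n/m⌉`, then the number of
partitions of `n` into at most `m` parts with largest part `⌈n/m⌉ + l` equals the
number of partitions of `m(l+1) - j` into at most `m - 1` parts. -/
theorem stmt_0 (m n l : ℕ) (hm : 2 ≤ m) (hn : 1 ≤ n)
    (j : ℤ) (hj : j = (m : ℤ) + (n : ℤ) - (m : ℤ) * ⌈(n : ℚ) / (m : ℚ)⌉)
    (hl : (l : ℝ) ≤ 1 / ((m : ℝ) - 1) * ((n : ℝ) / (m : ℝ) - (m : ℝ))) :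
    Nat.card {f : Fin m → ℕ // Antitone f ∧ (∑ i, f i) = n ∧
        ((f ⟨0, by omega⟩ : ℤ) = ⌈(n : ℚ) / (m : ℚ)⌉ + (l : ℤ))} =
      numPart ((m : ℤ) * ((l : ℤ) + 1) - j).toNat (m - 1) := by
  obtain ⟨k, rfl⟩ : ∃ k, m = k + 1 := ⟨m - 1, by omega⟩
  have hk : 0 < (k : ℝ) := by exact_mod_cast (by omega : 0 < k)
  have hpos : (0 : ℚ) < (k + 1 : ℕ) := by positivity
  obtain ⟨c, hc⟩ : ∃ c : ℕ, ⌈(n : ℚ) / ((k + 1 : ℕ) : ℚ)⌉ = c :=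
    Int.eq_ofNat_of_zero_le (Int.ceil_nonneg (by positivity))
  rw [hc] at hj
  have hnc : (n : ℚ) / (k + 1 : ℕ) ≤ c := by exact_mod_cast hc ▸ Int.le_ceil _
  have hcn : (c : ℚ) < (n : ℚ) / (k + 1 : ℕ) + 1 := by
    have := Int.ceil_lt_add_one ((n : ℚ) / (k + 1 : ℕ))
    rw [hc] at this
    exact_mod_cast this
  have hlower : n ≤ (k + 1) * c := by
    rw [div_le_iff₀ hpos, mul_comm] at hnc
    exact_mod_cast hnc
  have hupper : (k + 1) * c < n + (k + 1) := by
    rw [← sub_lt_iff_lt_add, lt_div_iff₀ hpos] at hcn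
    have : ((k : ℚ) + 1) * c < n + (k + 1) := by push_cast at hcn; linarith
    exact_mod_cast this
  have hbound : k * l + (k + 1) ≤ c := by
    have hnc' : (n : ℝ) / (k + 1 : ℕ) ≤ c := by
      have := (Rat.cast_le (K := ℝ)).2 hnc
      push_cast at this ⊢
      exact this
    rw [one_div, inv_mul_eq_div, Nat.cast_add_one, add_sub_cancel_right, le_div_iff₀ hk] at hl
    push_cast at hnc'
    have : (k : ℝ) * l + (k + 1) ≤ c := by linarith
    exact_mod_cast this
  have hN : (((k + 1 : ℕ) : ℤ) * ((l : ℤ) + 1) - j).toNat = (k + 1) * (c + l) - n := by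
    have : ((k + 1 : ℕ) : ℤ) * ((l : ℤ) + 1) - j = ((k + 1) * (c + l) : ℕ) - (n : ℤ) := by
      rw [hj]; push_cast; ring
    omega
  rw [hN, hc, add_tsub_cancel_right, ← card_largest_part_eq_numPart (M := c + l) (n := n)]
  · simp only [← Nat.cast_add, Nat.cast_inj]
    rfl
  · exact Nat.sub_add_cancel (by nlinarith)
  · rw [Nat.sub_le_iff_le_add]
    nlinarith
end

section
/- Let l ≥ 0, m ≥ 2 and n ≥ 1 be integers, and set j = m + n − m⌈n/m⌉ (so 1 ≤ j ≤ m). If (1/(m−1))·(n/m − m) < l ≤ n − ⌈n/m⌉, then the number of partitions (k₁,…,k_m) of n into at most m parts with largest part k₁ = ⌈n/m⌉ + l is at most |𝒫_{m(l+1)−j}(m−1)|, the number of partitions of m(l+1)−j into at most m−1 parts. -/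
open scoped BigOperators

theorem restPart_finite (N k : ℕ) : (restPart N k).Finite :=
  (Set.finite_Iic (fun _ : Fin k => N)).subset fun _ hf i =>
    hf.2 ▸ Finset.single_le_sum (fun _ _ => Nat.zero_le _) (Finset.mem_univ i)

/-- Complementing a partition of `n` into at most `k + 1` parts inside the `(k + 1) × a` box,
where `a` is its largest part, gives a partition of `N = (k + 1) * a - n` into at most `k` parts. -/
theorem complement_mem_restPart {k n a N : ℕ} {f : Fin (k + 1) → ℕ} (hf : Antitone f)
    (hsum : ∑ i, f i = n) (ha : f 0 = a) (hN : n + N = (k + 1) * a) :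
    (fun i : Fin k => a - f i.rev.succ) ∈ restPart N k := by
  refine ⟨fun x y hxy => Nat.sub_le_sub_left
    (hf (Fin.succ_le_succ_iff.2 (Fin.rev_le_rev.2 hxy))) a, ?_⟩
  have hle (i : Fin k) : f i.succ ≤ a := ha ▸ hf (Fin.zero_le _)
  have hadd : ∑ i : Fin k, (a - f i.succ) + ∑ i : Fin k, f i.succ = k * a := by
    simp [← Finset.sum_add_distrib, Nat.sub_add_cancel (hle _)]
  rw [Fin.sum_univ_succ, ha] at hsum
  rw [show ∑ i : Fin k, (a - f i.rev.succ) = ∑ i : Fin k, (a - f i.succ) from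
    Equiv.sum_comp Fin.revPerm fun i => a - f i.succ]
  linarith

/-- The partitions of `n` into at most `k + 1` parts with largest part `a` are at most as many
as the partitions of `(k + 1) * a - n` into at most `k` parts. -/
theorem card_largest_part_le_numPart {k n a N : ℕ} (hN : n + N = (k + 1) * a) :
    Nat.card {f : Fin (k + 1) → ℕ // Antitone f ∧ ∑ i, f i = n ∧ f 0 = a} ≤ numPart N k := by
  have := (restPart_finite N k).to_subtype
  refine Nat.card_le_card_of_injective
    (fun f => (⟨_, complement_mem_restPart f.2.1 f.2.2.1 f.2.2.2 hN⟩ : restPart N k)) ?_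
  rintro ⟨f, hf, _, hf0⟩ ⟨g, hg, _, hg0⟩ h
  refine Subtype.ext (funext (Fin.cases (hf0.trans hg0.symm) fun i => ?_))
  have hi := congrFun (congrArg Subtype.val h) i.rev
  simp only [Fin.rev_rev] at hi
  have h1 := hf (Fin.zero_le i.succ)
  have h2 := hg (Fin.zero_le i.succ)
  lia

/-- If `(1/(m-1))(n/m - m) < l ≤ n - ⌈n/m⌉` and `j = m + n - m⌈n/m⌉`, then the number of
partitions of `n` into at most `m` parts with largest part `⌈n/m⌉ + l` is at most the
number of partitions of `m(l+1) - j` into at most `m - 1` parts. -/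
theorem stmt_1 (m n l : ℕ) (hm : 2 ≤ m) (hn : 1 ≤ n)
    (j : ℤ) (hj : j = (m : ℤ) + (n : ℤ) - (m : ℤ) * ⌈(n : ℚ) / (m : ℚ)⌉)
    (hl1 : 1 / ((m : ℝ) - 1) * ((n : ℝ) / (m : ℝ) - (m : ℝ)) < (l : ℝ))
    (hl2 : (l : ℝ) ≤ (n : ℝ) - ((⌈(n : ℚ) / (m : ℚ)⌉ : ℤ) : ℝ)) :
    Nat.card {f : Fin m → ℕ // Antitone f ∧ (∑ i, f i) = n ∧
        ((f ⟨0, by omega⟩ : ℤ) = ⌈(n : ℚ) / (m : ℚ)⌉ + (l : ℤ))} ≤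
      numPart ((m : ℤ) * ((l : ℤ) + 1) - j).toNat (m - 1) := by
  obtain ⟨k, rfl⟩ : ∃ k, m = k + 1 := ⟨m - 1, by lia⟩
  have hpos : (0 : ℚ) < ((k + 1 : ℕ) : ℚ) := by positivity
  have hceil : (n : ℤ) ≤ ((k + 1 : ℕ) : ℤ) * ⌈(n : ℚ) / ((k + 1 : ℕ) : ℚ)⌉ := by
    have h := (div_le_iff₀' hpos).1 (Int.le_ceil ((n : ℚ) / ((k + 1 : ℕ) : ℚ)))
    exact_mod_cast h
  have hc0 : 0 ≤ ⌈(n : ℚ) / ((k + 1 : ℕ) : ℚ)⌉ := Int.ceil_nonneg (by positivity)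
  obtain ⟨c, hc⟩ := Int.eq_ofNat_of_zero_le hc0
  rw [hc] at hceil hj
  have hN : n + (((k + 1 : ℕ) : ℤ) * ((l : ℤ) + 1) - j).toNat = (k + 1) * (c + l) := by
    have hrw : ((k + 1 : ℕ) : ℤ) * ((l : ℤ) + 1) - j
        = ((k + 1 : ℕ) : ℤ) * c - n + ((k + 1 : ℕ) : ℤ) * l := by rw [hj]; ring
    have hl : (0 : ℤ) ≤ ((k + 1 : ℕ) : ℤ) * l := by positivity
    rw [hrw, ← Nat.cast_inj (R := ℤ), Nat.cast_add, Int.toNat_of_nonneg (by linarith)]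
    push_cast
    ring
  simp only [hc, ← Nat.cast_add, Nat.cast_inj]
  exact_mod_cast card_largest_part_le_numPart hN
end

section
/- Fix an integer m ≥ 2 and q ∈ (0,1). For each n, let κ = (k₁,…,k_m) ∈ 𝒫_n(m) be chosen with probability P(κ) = c·q^{k₁}, where c = c_{n,m} is the normalizing constant. Fix j₀ ∈ {0,1,…,m−1} and consider the subsequence of n with n ≡ j₀ (mod m); define j = j₀ if 1 ≤ j₀ ≤ m−1 and j = m if j₀ = 0. Then as n → ∞ along this subsequence, the random vector (k₁ − ⌈n/m⌉, …, k_m − ⌈n/m⌉) converges in distribution to the discrete random vector with probability mass function f(l₁,…,l_m) = q^{l₁} / Σ_{l=0}^∞ q^{l}·|𝒫_{m(l+1)−j}(m−1)|, supported on integer vectors (l₁,…,l_m) with l₁ ≥ 0, l₁ ≥ l₂ ≥ … ≥ l_m, and Σ_{i=1}^m l_i = j − m. -/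
open scoped BigOperators Classical

/-- Total weight `∑ q^{k₁}` of partitions of `n` into at most `m` parts lying in the
event `E`, where `k₁` is the largest part. -/
noncomputable def geomWeight (q : ℝ) (n m : ℕ) (hm : 0 < m) (E : Set (Fin m → ℕ)) : ℝ :=
  ∑' f : {g : Fin m → ℕ // (Antitone g ∧ ∑ i, g i = n) ∧ g ∈ E}, q ^ (f.1 ⟨0, hm⟩)

/-- Probability of the event `E` under the restricted geometric distribution
`P(κ) = c q^{k₁}` on partitions of `n` into at most `m` parts. -/
noncomputable def geomProb (q : ℝ) (n m : ℕ) (hm : 0 < m) (E : Set (Fin m → ℕ)) : ℝ :=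
  geomWeight q n m hm E / geomWeight q n m hm Set.univ

theorem restPart_subset_Iic (N k : ℕ) : restPart N k ⊆ Set.Iic (fun _ => N) := by
  rintro f ⟨-, hf⟩ i
  rw [← hf]
  exact Finset.single_le_sum (f := f) (fun _ _ => Nat.zero_le _) (Finset.mem_univ i)

instance finite_restPart (N k : ℕ) : Finite (restPart N k) :=
  ((Set.finite_Iic _).subset (restPart_subset_Iic N k)).to_subtype

theorem numPart_le (N k : ℕ) : numPart N k ≤ (N + 1) ^ k := by
  calc numPart N k ≤ Nat.card (Set.Iic (fun _ : Fin k => N)) :=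
        Nat.card_mono (Set.finite_Iic _) (restPart_subset_Iic N k)
    _ = (N + 1) ^ k := by
        rw [Nat.card_eq_fintype_card, ← Set.toFinset_card, Set.toFinset_Iic, Pi.card_Iic]
        simp

/-- Pairs of a natural number `i` and a partition of `m (i + 1) - j` into at most `m - 1` parts,
where `m = p + 1`; `i` is the offset of the largest part, the partition records its gaps to the
other parts. -/
abbrev GapData (p j : ℕ) : Type := Σ i : ℕ, restPart ((p + 1) * (i + 1) - j) p

theorem tsum_restPart_const (N k : ℕ) (a : ℝ) :
    ∑' _ : restPart N k, a = a * (numPart N k : ℝ) := by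
  rw [tsum_const, nsmul_eq_mul, mul_comm, numPart]

theorem summable_pow_mul_numPart {q : ℝ} (hq : q ∈ Set.Ioo (0 : ℝ) 1) (p j : ℕ) :
    Summable fun i : ℕ => q ^ i * (numPart ((p + 1) * (i + 1) - j) p : ℝ) := by
  have hs : Summable fun i : ℕ => ((i + 1 : ℕ) : ℝ) ^ p * q ^ (i + 1) :=
    (summable_nat_add_iff (f := fun n : ℕ => (n : ℝ) ^ p * q ^ n) 1).2
      (summable_pow_mul_geometric_of_norm_lt_one p
        (by rw [Real.norm_of_nonneg hq.1.le]; exact hq.2))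
  refine Summable.of_nonneg_of_le (fun i => ?_) (fun i => ?_)
    (hs.mul_left (((p + 2 : ℕ) : ℝ) ^ p * q⁻¹))
  · have := hq.1
    positivity
  · have hle : numPart ((p + 1) * (i + 1) - j) p ≤ ((p + 2) * (i + 1)) ^ p :=
      (numPart_le _ _).trans (Nat.pow_le_pow_left
        (by have := Nat.sub_le ((p + 1) * (i + 1)) j; nlinarith) p)
    have hle' : (numPart ((p + 1) * (i + 1) - j) p : ℝ)
        ≤ ((p + 2 : ℕ) : ℝ) ^ p * ((i + 1 : ℕ) : ℝ) ^ p := by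
      rw [← mul_pow]; exact_mod_cast hle
    have hq0 : q ≠ 0 := hq.1.ne'
    calc q ^ i * (numPart ((p + 1) * (i + 1) - j) p : ℝ)
        ≤ q ^ i * (((p + 2 : ℕ) : ℝ) ^ p * ((i + 1 : ℕ) : ℝ) ^ p) :=
          mul_le_mul_of_nonneg_left hle' (pow_nonneg hq.1.le i)
      _ = ((p + 2 : ℕ) : ℝ) ^ p * q⁻¹ * (((i + 1 : ℕ) : ℝ) ^ p * q ^ (i + 1)) := by
          rw [pow_succ q i]; field_simp

theorem summable_gapData {q : ℝ} (hq : q ∈ Set.Ioo (0 : ℝ) 1) (p j : ℕ) :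
    Summable fun x : GapData p j => q ^ x.1 := by
  refine (summable_sigma_of_nonneg fun x => pow_nonneg hq.1.le _).2 ⟨fun i => ?_, ?_⟩
  · exact Summable.of_finite
  · simpa only [tsum_restPart_const] using summable_pow_mul_numPart hq p j

theorem tsum_gapData {q : ℝ} (hq : q ∈ Set.Ioo (0 : ℝ) 1) (p j : ℕ) :
    ∑' x : GapData p j, q ^ x.1
      = ∑' i : ℕ, q ^ i * (numPart ((p + 1) * (i + 1) - j) p : ℝ) := by
  rw [(summable_gapData hq p j).tsum_sigma]
  simp only [tsum_restPart_const]

theorem nonempty_gapData {p : ℕ} (hp : 0 < p) (j : ℕ) : Nonempty (GapData p j) := by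
  refine ⟨⟨0, fun k => if k = ⟨0, hp⟩ then (p + 1) * (0 + 1) - j else 0, ?_, by simp⟩⟩
  intro a b hab
  by_cases hb : b = ⟨0, hp⟩
  · have ha : a = ⟨0, hp⟩ := by subst hb; exact Fin.ext (Nat.le_zero.1 hab)
    simp [ha, hb]
  · simp [hb]

theorem tsum_gapData_pos {q : ℝ} (hq : q ∈ Set.Ioo (0 : ℝ) 1) {p : ℕ} (hp : 0 < p) (j : ℕ) :
    0 < ∑' x : GapData p j, q ^ x.1 := by
  obtain ⟨x⟩ := nonempty_gapData hp j
  exact (summable_gapData hq p j).tsum_pos (fun _ => pow_nonneg hq.1.le _) x (pow_pos hq.1 _)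

theorem le_apply_zero_of_sum {p j c n : ℕ} (hj : 1 ≤ j) (hn : n + (p + 1) = (p + 1) * c + j)
    {f : Fin (p + 1) → ℕ} (hf : Antitone f) (hsum : ∑ i, f i = n) : c ≤ f 0 := by
  have h : n ≤ (p + 1) * f 0 := by
    rw [← hsum]
    simpa using Finset.sum_le_card_nsmul Finset.univ f (f 0) fun i _ => hf (Fin.zero_le i)
  by_contra! hlt
  have := Nat.mul_le_mul_left (p + 1) (Nat.succ_le_of_lt hlt)
  rw [Nat.succ_eq_add_one, mul_add, mul_one] at this
  omega

/-- A partition of `n = m c + j - m` into at most `m = p + 1` parts is determined by the offset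
of its largest part from `c` and the gaps between the largest part and the other ones. -/
def partitionEquivGapData {p j c n : ℕ} (hj : 1 ≤ j) (hjp : j ≤ p + 1)
    (hn : n + (p + 1) = (p + 1) * c + j) :
    {g : Fin (p + 1) → ℕ // (Antitone g ∧ ∑ i, g i = n) ∧ g ∈ Set.univ} ≃
      {x : GapData p j | ∀ k, x.2.1 k ≤ x.1 + c} where
  toFun f := ⟨⟨f.1 0 - c, fun k => f.1 0 - f.1 (Fin.rev k).succ, by
      obtain ⟨f, ⟨hf, hsum⟩, -⟩ := f
      have hc := le_apply_zero_of_sum hj hn hf hsum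
      refine ⟨fun a b hab => Nat.sub_le_sub_left
        (hf (Fin.succ_le_succ_iff.2 (Fin.rev_le_rev.2 hab))) _, ?_⟩
      have h1 : ∑ k : Fin p, (f 0 - f (Fin.rev k).succ) + ∑ k : Fin p, f (Fin.rev k).succ
          = p * f 0 := by
        rw [← Finset.sum_add_distrib,
          Finset.sum_congr rfl fun k _ => Nat.sub_add_cancel (hf (Fin.zero_le _))]
        simp
      have h2 : ∑ k : Fin p, f (Fin.rev k).succ = ∑ k : Fin p, f k.succ :=
        Equiv.sum_comp Fin.revPerm fun k => f k.succ
      rw [Fin.sum_univ_succ] at hsum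
      dsimp only
      refine Nat.eq_sub_of_add_eq ?_
      obtain ⟨d, hd⟩ := Nat.exists_eq_add_of_le hc
      have h3 : f 0 - c = d := by omega
      have h4 : p * f 0 = p * c + p * d := by rw [hd, mul_add]
      rw [h3]
      linarith⟩, by
      obtain ⟨f, ⟨hf, hsum⟩, -⟩ := f
      have hc := le_apply_zero_of_sum hj hn hf hsum
      intro k
      change f 0 - f (Fin.rev k).succ ≤ f 0 - c + c
      omega⟩
  invFun x := ⟨Fin.cons (x.1.1 + c) fun k => x.1.1 + c - x.1.2.1 (Fin.rev k), by
      obtain ⟨⟨i, g, hg, hsum⟩, hx⟩ := x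
      replace hx : ∀ k, g k ≤ i + c := hx
      refine ⟨⟨?_, ?_⟩, trivial⟩
      · intro a b hab
        induction a using Fin.cases with
        | zero =>
          induction b using Fin.cases with
          | zero => exact le_rfl
          | succ b => exact Nat.sub_le _ _
        | succ a =>
          induction b using Fin.cases with
          | zero => exact absurd hab (by simp)
          | succ b =>
            exact Nat.sub_le_sub_left (hg (Fin.rev_le_rev.2 (Fin.succ_le_succ_iff.1 hab))) _
      · rw [Fin.sum_univ_succ]
        simp only [Fin.cons_zero, Fin.cons_succ]
        have h1 : ∑ k : Fin p, (i + c - g (Fin.rev k)) + ∑ k : Fin p, g (Fin.rev k)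
            = p * (i + c) := by
          rw [← Finset.sum_add_distrib,
            Finset.sum_congr rfl fun k _ => Nat.sub_add_cancel (hx _)]
          simp
        have h2 : ∑ k : Fin p, g (Fin.rev k) = ∑ k : Fin p, g k :=
          Equiv.sum_comp Fin.revPerm g
        have hle : j ≤ (p + 1) * (i + 1) := by nlinarith
        have h3 := Nat.sub_add_cancel hle
        rw [← hsum] at h3
        nlinarith⟩
  left_inv := by
    rintro ⟨f, ⟨hf, hsum⟩, hu⟩
    have hc := le_apply_zero_of_sum hj hn hf hsum
    refine Subtype.ext (funext fun k => ?_)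
    induction k using Fin.cases with
    | zero => exact Nat.sub_add_cancel hc
    | succ k =>
      have := hf (Fin.zero_le k.succ)
      simp only [Fin.cons_succ, Fin.rev_rev]
      omega
  right_inv := by
    rintro ⟨⟨i, g, hg, hsum⟩, hx⟩
    replace hx : ∀ k, g k ≤ i + c := hx
    refine Subtype.ext (Sigma.subtype_ext (Nat.add_sub_cancel i c) (funext fun k => ?_))
    have := hx k
    simp only [Fin.cons_zero, Fin.cons_succ, Fin.rev_rev]
    omega

theorem geomWeight_univ_eq (q : ℝ) {p j c n : ℕ} (hj : 1 ≤ j) (hjp : j ≤ p + 1)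
    (hn : n + (p + 1) = (p + 1) * c + j) :
    geomWeight q n (p + 1) p.succ_pos Set.univ = q ^ c *
      ∑' x : GapData p j, {x : GapData p j | ∀ k, x.2.1 k ≤ x.1 + c}.indicator
        (fun x => q ^ x.1) x := by
  rw [← tsum_subtype, ← tsum_mul_left, ← (partitionEquivGapData hj hjp hn).tsum_eq]
  refine tsum_congr fun f => ?_
  have hc := le_apply_zero_of_sum hj hn f.2.1.1 f.2.1.2
  change q ^ f.1 0 = q ^ c * q ^ (f.1 0 - c)
  rw [← pow_add, Nat.add_sub_cancel' hc]

theorem tendsto_tsum_indicator_gapData {q : ℝ} (hq : q ∈ Set.Ioo (0 : ℝ) 1) (p j : ℕ) :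
    Filter.Tendsto (fun c : ℕ => ∑' x : GapData p j,
      {x : GapData p j | ∀ k, x.2.1 k ≤ x.1 + c}.indicator (fun x => q ^ x.1) x)
      Filter.atTop (nhds (∑' x : GapData p j, q ^ x.1)) := by
  refine tendsto_tsum_of_dominated_convergence (summable_gapData hq p j) (fun x => ?_)
    (Filter.Eventually.of_forall fun c x => ?_)
  · refine tendsto_const_nhds.congr' ?_
    filter_upwards [Filter.eventually_ge_atTop ((p + 1) * (x.1 + 1) - j)] with c hc
    refine (Set.indicator_of_mem (f := fun x : GapData p j => q ^ x.1) ?_).symm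
    exact fun k => (restPart_subset_Iic _ _ x.2.2 k).trans (hc.trans (Nat.le_add_left _ _))
  · refine (norm_indicator_le_norm_self _ _).trans_eq ?_
    exact Real.norm_of_nonneg (pow_nonneg hq.1.le _)

theorem ceil_mul_add_div {m j₀ : ℕ} (hj₀ : j₀ < m) (t : ℕ) :
    ⌈((m * t + j₀ : ℕ) : ℚ) / (m : ℚ)⌉ = ((t + if j₀ = 0 then 0 else 1 : ℕ) : ℤ) := by
  have hm : (0 : ℚ) < m := by exact_mod_cast (Nat.zero_le j₀).trans_lt hj₀
  have hlt : (j₀ : ℚ) < m := by exact_mod_cast hj₀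
  rw [Int.ceil_eq_iff, lt_div_iff₀ hm, div_le_iff₀ hm]
  split_ifs with h
  · subst h
    push_cast
    constructor <;> nlinarith
  · have hpos : (0 : ℚ) < j₀ := by exact_mod_cast Nat.pos_of_ne_zero h
    push_cast
    constructor <;> nlinarith

theorem geomWeight_eq_zero (q : ℝ) {n m : ℕ} (hm : 0 < m) {E : Set (Fin m → ℕ)}
    (hE : ∀ f ∈ E, Antitone f → ∑ i, f i ≠ n) : geomWeight q n m hm E = 0 := by
  have : IsEmpty {g : Fin m → ℕ // (Antitone g ∧ ∑ i, g i = n) ∧ g ∈ E} :=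
    ⟨fun g => hE g.1 g.2.2 g.2.1.1 g.2.1.2⟩
  exact tsum_empty

theorem geomWeight_singleton (q : ℝ) {n m : ℕ} (hm : 0 < m) {f : Fin m → ℕ} (hf : Antitone f)
    (hsum : ∑ i, f i = n) : geomWeight q n m hm {f} = q ^ f ⟨0, hm⟩ := by
  rw [geomWeight, tsum_eq_single ⟨f, ⟨hf, hsum⟩, rfl⟩]
  rintro ⟨g, hg, hgf⟩ hne
  exact absurd (Subtype.ext (Set.mem_singleton_iff.1 hgf)) hne

/-- Along the subsequence `n = m t + j₀`, the vector `(k₁ - ⌈n/m⌉, …, k_m - ⌈n/m⌉)` of a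
restricted-geometric random partition converges in distribution to the discrete law with
pmf `q^{l₁} / ∑_{l≥0} q^l |𝒫_{m(l+1)-j}(m-1)|` on the stated support. -/
theorem stmt_2 (m : ℕ) (hm : 2 ≤ m) (q : ℝ) (hq : q ∈ Set.Ioo (0 : ℝ) 1)
    (j₀ : ℕ) (hj₀ : j₀ < m) (j : ℕ) (hj : j = if j₀ = 0 then m else j₀)
    (l : Fin m → ℤ) :
    Filter.Tendsto
      (fun t : ℕ => geomProb q (m * t + j₀) m (by omega)
        {f | ∀ i : Fin m, (f i : ℤ) = ⌈((m * t + j₀ : ℕ) : ℚ) / (m : ℚ)⌉ + l i})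
      Filter.atTop
      (nhds (if 0 ≤ l ⟨0, by omega⟩ ∧ Antitone l ∧ (∑ i, l i) = (j : ℤ) - (m : ℤ)
        then q ^ (l ⟨0, by omega⟩).toNat /
          ∑' i : ℕ, q ^ i * (numPart (m * (i + 1) - j) (m - 1) : ℝ)
        else 0)) := by
  obtain ⟨p, rfl⟩ : ∃ p, m = p + 1 := ⟨m - 1, by omega⟩
  have hp : 0 < p := by omega
  have hj1 : 1 ≤ j := by rw [hj]; split_ifs <;> omega
  have hjp : j ≤ p + 1 := by rw [hj]; split_ifs <;> omega
  set c : ℕ → ℕ := fun t => t + if j₀ = 0 then 0 else 1 with hc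
  have hn (t : ℕ) : (p + 1) * t + j₀ + (p + 1) = (p + 1) * c t + j := by
    simp only [hc, hj]
    split_ifs with h
    · rw [h]; ring
    · ring
  have hceil (t : ℕ) : ⌈(((p + 1) * t + j₀ : ℕ) : ℚ) / ((p + 1 : ℕ) : ℚ)⌉ = (c t : ℤ) :=
    ceil_mul_add_div hj₀ t
  simp only [hceil]
  split_ifs with hl
  · obtain ⟨hl0, hanti, hsum⟩ := hl
    have hctop : Filter.Tendsto c Filter.atTop Filter.atTop :=
      Filter.tendsto_atTop_mono (fun t => Nat.le_add_right t _) Filter.tendsto_id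
    have hlim := (tendsto_tsum_indicator_gapData hq p j).comp hctop
    have hdiv := (tendsto_const_nhds (x := q ^ (l 0).toNat)).div hlim
      (tsum_gapData_pos hq hp j).ne'
    rw [tsum_gapData hq] at hdiv
    refine hdiv.congr' ?_
    filter_upwards [hctop.eventually_ge_atTop (∑ i, (l i).natAbs)] with t ht
    have hnn (i : Fin (p + 1)) : 0 ≤ (c t : ℤ) + l i := by
      have := Finset.single_le_sum (f := fun i => (l i).natAbs) (fun _ _ => Nat.zero_le _)
        (Finset.mem_univ i)
      omega
    have hset : {f : Fin (p + 1) → ℕ | ∀ i, (f i : ℤ) = (c t : ℤ) + l i}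
        = {fun i => ((c t : ℤ) + l i).toNat} := by
      ext f
      simp only [Set.mem_ofPred_eq, Set.mem_singleton_iff, funext_iff]
      refine forall_congr' fun i => ?_
      have := hnn i
      omega
    have hnum : ∑ i, ((c t : ℤ) + l i).toNat = (p + 1) * t + j₀ := by
      zify
      simp only [Int.toNat_of_nonneg (hnn _), Finset.sum_add_distrib, hsum]
      have := hn t
      zify at this
      simp
      linarith
    have hz : ((c t : ℤ) + l 0).toNat = c t + (l 0).toNat := by
      have : 0 ≤ l 0 := hl0
      omega
    rw [geomProb, hset, geomWeight_singleton q _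
      (fun a b hab => Int.toNat_le_toNat (by have := hanti hab; omega)) hnum,
      geomWeight_univ_eq q hj1 hjp (hn t)]
    change _ = q ^ ((c t : ℤ) + l 0).toNat / _
    rw [hz, pow_add, mul_div_mul_left _ _ (pow_pos hq.1 _).ne']
    rfl
  · refine tendsto_const_nhds.congr fun t => ?_
    rw [geomProb, geomWeight_eq_zero, zero_div]
    intro f hf hanti hsum
    refine hl ⟨?_, fun a b hab => ?_, ?_⟩
    · have h1 := le_apply_zero_of_sum hj1 (hn t) hanti hsum
      have h2 := hf 0
      change 0 ≤ l 0
      omega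
    · have h1 := hf a
      have h2 := hf b
      have h3 := hanti hab
      omega
    · have h1 : ∑ i, (f i : ℤ) = (p + 1) * c t + ∑ i, l i := by
        rw [Finset.sum_congr rfl fun i _ => hf i, Finset.sum_add_distrib]
        simp
      have h2 := hn t
      zify at hsum h2
      push_cast
      linarith
end

section
/- Fix an integer m ≥ 2 and q ∈ (0,1). For each n, let κ = (k₁,…,k_m) ∈ 𝒫_n(m) be chosen with probability P(κ) = c·q^{k₁}. Fix j₀ ∈ {0,1,…,m−1} and consider the subsequence of n with n ≡ j₀ (mod m); define j = j₀ if 1 ≤ j₀ ≤ m−1, j = m if j₀ = 0. Then for any fixed integer l₁ ≥ 0, as n → ∞ along this subsequence, the conditional distribution of (k₂ − ⌈n/m⌉, …, k_m − ⌈n/m⌉) given k₁ = ⌈n/m⌉ + l₁ converges to the uniform distribution on the finite set {(l₂,…,l_m) ∈ ℤ^{m−1} : l₁ ≥ l₂ ≥ … ≥ l_m and l₁ + Σ_{i=2}^m l_i = j − m}. -/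
open scoped BigOperators

theorem geomWeight_eq_card_mul_pow (q : ℝ) (n m : ℕ) (hm : 0 < m) (E : Set (Fin m → ℕ)) (K : ℕ)
    (hE : ∀ f ∈ E, f ⟨0, hm⟩ = K) :
    geomWeight q n m hm E =
      Nat.card {g : Fin m → ℕ // (Antitone g ∧ ∑ i, g i = n) ∧ g ∈ E} * q ^ K := by
  unfold geomWeight
  rw [← nsmul_eq_mul, ← tsum_const]
  exact tsum_congr fun f => by rw [hE f.1 f.2.2]

theorem geomWeight_univ_pos (q : ℝ) (hq : 0 < q) (n m : ℕ) (hm : 0 < m) (f : Fin m → ℕ)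
    (hf : Antitone f) (hs : ∑ i, f i = n) : 0 < geomWeight q n m hm Set.univ := by
  have hfin : Finite {g : Fin m → ℕ // (Antitone g ∧ ∑ i, g i = n) ∧ g ∈ Set.univ} := by
    refine Set.Finite.subset (Set.finite_Iic (fun _ : Fin m => n)) ?_
    rintro g ⟨⟨-, hg⟩, -⟩ i
    rw [← hg]
    exact Finset.single_le_sum (f := g) (fun _ _ => Nat.zero_le _) (Finset.mem_univ i)
  exact (Summable.of_finite).tsum_pos (fun g => by positivity)
    ⟨f, ⟨hf, hs⟩, Set.mem_univ _⟩ (by positivity)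

theorem mul_ceil_div_eq (m t j₀ : ℕ) (hj₀ : j₀ < m) :
    (m : ℤ) * ⌈((m * t + j₀ : ℕ) : ℚ) / (m : ℚ)⌉ =
      (m * t + j₀ : ℕ) + m - ((if j₀ = 0 then m else j₀ : ℕ) : ℤ) := by
  have hm : (0 : ℚ) < m := by exact_mod_cast (by omega : 0 < m)
  have hlt : (j₀ : ℚ) < m := by exact_mod_cast hj₀
  split_ifs with h
  · have : ⌈((m * t + j₀ : ℕ) : ℚ) / (m : ℚ)⌉ = (t : ℤ) := by
      subst h
      push_cast
      rw [add_zero, mul_div_cancel_left₀ _ hm.ne']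
      exact Int.ceil_natCast t
    rw [this]; subst h; push_cast; ring
  · have hpos : (0 : ℚ) < j₀ := by exact_mod_cast Nat.pos_of_ne_zero h
    have : ⌈((m * t + j₀ : ℕ) : ℚ) / (m : ℚ)⌉ = (t : ℤ) + 1 := by
      rw [Int.ceil_eq_iff, lt_div_iff₀ hm, div_le_iff₀ hm]
      push_cast
      constructor <;> nlinarith
    rw [this]; push_cast; ring

/-- A vector bounded above by `a ≥ 0` has every coordinate at least its sum minus `m * a`. -/
theorem sum_sub_mul_le_apply {m : ℕ} (l : Fin m → ℤ) (a : ℤ) (ha : 0 ≤ a) (h : ∀ i, l i ≤ a)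
    (i : Fin m) : ∑ k, l k - m * a ≤ l i := by
  have h1 : ∑ k ∈ Finset.univ.erase i, l k ≤ ∑ _k ∈ Finset.univ.erase i, a :=
    Finset.sum_le_sum fun k _ => h k
  have h2 : ∑ _k ∈ Finset.univ.erase i, a ≤ ∑ _k : Fin m, a :=
    Finset.sum_le_sum_of_subset_of_nonneg (Finset.erase_subset _ _) fun _ _ _ => ha
  have h3 := Finset.add_sum_erase Finset.univ l (Finset.mem_univ i)
  rw [Fin.sum_const, nsmul_eq_mul] at h2
  linarith

/-- Translation by `C` identifies partitions of `n` with largest part `C + a` and decreasing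
integer vectors with first coordinate `a` and sum `n - m * C`, once `C` is large. -/
def translateEquiv (n m : ℕ) (hm : 0 < m) (C a s : ℤ) (ha : 0 ≤ a) (hs : m * C + s = n)
    (hC : m * a - s ≤ C) :
    {l : Fin m → ℤ // l ⟨0, hm⟩ = a ∧ Antitone l ∧ ∑ i, l i = s} ≃
      {g : Fin m → ℕ // (Antitone g ∧ ∑ i, g i = n) ∧
        g ∈ {f : Fin m → ℕ | (f ⟨0, hm⟩ : ℤ) = C + a}} :=
  have key (l : {l : Fin m → ℤ // l ⟨0, hm⟩ = a ∧ Antitone l ∧ ∑ i, l i = s}) (i : Fin m) :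
      ((C + l.1 i).toNat : ℤ) = C + l.1 i := by
    obtain ⟨l, h0, hl, hsum⟩ := l
    have := sum_sub_mul_le_apply l a ha
      (fun k => h0 ▸ hl (show (⟨0, hm⟩ : Fin m) ≤ k from Nat.zero_le _)) i
    exact Int.toNat_of_nonneg (by simp only; linarith)
  { toFun := fun l => ⟨fun i => (C + l.1 i).toNat, by
      refine ⟨⟨fun i k hik => Int.toNat_le_toNat ?_, ?_⟩, ?_⟩
      · linarith [l.2.2.1 hik]
      · have : ((∑ i, (C + l.1 i).toNat : ℕ) : ℤ) = n := by
          rw [Nat.cast_sum, Finset.sum_congr rfl fun i _ => key l i, Finset.sum_add_distrib, l.2.2.2]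
          simpa using hs
        exact_mod_cast this
      · rw [Set.mem_ofPred_eq, key l, l.2.1]⟩
    invFun := fun g => ⟨fun i => (g.1 i : ℤ) - C, by
      refine ⟨?_, fun i k hik => ?_, ?_⟩
      · have := g.2.2
        rw [Set.mem_ofPred_eq] at this
        linarith
      · have : (g.1 k : ℤ) ≤ g.1 i := by exact_mod_cast g.2.1.1 hik
        linarith
      · have : ∑ i, (g.1 i : ℤ) = n := by exact_mod_cast g.2.1.2
        rw [Finset.sum_sub_distrib, this]
        simp
        linarith⟩
    left_inv := fun l => Subtype.ext <| funext fun i => by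
      have := key l i
      simp only
      linarith
    right_inv := fun g => Subtype.ext <| funext fun i => by simp }

/-- Along the subsequence `n = m t + j₀`, for a fixed admissible integer vector `l` with
`l₁ = l ⟨0⟩ ≥ 0`, the conditional distribution of `(k₂ - ⌈n/m⌉, …, k_m - ⌈n/m⌉)` given
`k₁ = ⌈n/m⌉ + l₁` converges to the uniform distribution on the finite set
`{(l₂,…,l_m) : l₁ ≥ l₂ ≥ … ≥ l_m, l₁ + Σ l_i = j - m}`. -/
theorem stmt_4 (m : ℕ) (hm : 2 ≤ m) (q : ℝ) (hq : q ∈ Set.Ioo (0 : ℝ) 1)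
    (j₀ : ℕ) (hj₀ : j₀ < m) (j : ℕ) (hj : j = if j₀ = 0 then m else j₀)
    (l : Fin m → ℤ) (hl0 : 0 ≤ l ⟨0, by omega⟩) (hla : Antitone l)
    (hls : (∑ i, l i) = (j : ℤ) - (m : ℤ)) :
    Filter.Tendsto
      (fun t : ℕ =>
        geomProb q (m * t + j₀) m (by omega)
            {f | ∀ i : Fin m, (f i : ℤ) = ⌈((m * t + j₀ : ℕ) : ℚ) / (m : ℚ)⌉ + l i} /
          geomProb q (m * t + j₀) m (by omega)
            {f | (f ⟨0, by omega⟩ : ℤ) =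
              ⌈((m * t + j₀ : ℕ) : ℚ) / (m : ℚ)⌉ + l ⟨0, by omega⟩})
      Filter.atTop
      (nhds (1 / (Nat.card {l' : Fin m → ℤ //
        l' ⟨0, by omega⟩ = l ⟨0, by omega⟩ ∧ Antitone l' ∧
          (∑ i, l' i) = (j : ℤ) - (m : ℤ)} : ℝ))) := by
  have hm0 : 0 < m := by omega
  apply tendsto_const_nhds.congr'
  filter_upwards [Filter.eventually_ge_atTop (m * l ⟨0, hm0⟩ - ((j : ℤ) - m)).toNat] with t ht
  have hceil := mul_ceil_div_eq m t j₀ hj₀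
  rw [← hj] at hceil
  have hCt : (t : ℤ) ≤ ⌈((m * t + j₀ : ℕ) : ℚ) / (m : ℚ)⌉ := by
    have hjm : j ≤ m := by rw [hj]; split_ifs <;> omega
    have : (m : ℤ) * t ≤ m * ⌈((m * t + j₀ : ℕ) : ℚ) / (m : ℚ)⌉ := by
      rw [hceil]; push_cast; omega
    exact le_of_mul_le_mul_left this (by exact_mod_cast hm0)
  generalize ⌈((m * t + j₀ : ℕ) : ℚ) / (m : ℚ)⌉ = C at hceil hCt ⊢
  generalize m * t + j₀ = n at hceil ⊢
  have hC : m * l ⟨0, hm0⟩ - ((j : ℤ) - m) ≤ C := (Int.toNat_le.mp ht).trans hCt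
  let e := translateEquiv n m hm0 C (l ⟨0, hm0⟩) ((j : ℤ) - m) hl0 (by linarith) hC
  let g := e ⟨l, rfl, hla, hls⟩
  have hg (i : Fin m) : (g.1 i : ℤ) = C + l i := by
    have := congrFun (congrArg Subtype.val (e.symm_apply_apply ⟨l, rfl, hla, hls⟩)) i
    change (g.1 i : ℤ) - C = l i at this
    linarith
  have hZ := geomWeight_univ_pos q hq.1 n m hm0 g.1 g.2.1.1 g.2.1.2
  have huniq : Nat.card {f : Fin m → ℕ // (Antitone f ∧ ∑ i, f i = n) ∧
      f ∈ {f : Fin m → ℕ | ∀ i : Fin m, (f i : ℤ) = C + l i}} = 1 := by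
    rw [Nat.card_eq_one_iff_unique]
    refine ⟨⟨fun a b => Subtype.ext <| funext fun i => ?_⟩, ⟨g.1, g.2.1, hg⟩⟩
    have := (a.2.2 i).trans (b.2.2 i).symm
    exact_mod_cast this
  have hlead (f : Fin m → ℕ)
      (hf : f ∈ {f : Fin m → ℕ | (f ⟨0, hm0⟩ : ℤ) = C + l ⟨0, hm0⟩}) :
      f ⟨0, hm0⟩ = g.1 ⟨0, hm0⟩ := by
    rw [Set.mem_ofPred_eq] at hf
    have := hf.trans (hg ⟨0, hm0⟩).symm
    exact_mod_cast this
  have hleadl (f : Fin m → ℕ)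
      (hf : f ∈ {f : Fin m → ℕ | ∀ i : Fin m, (f i : ℤ) = C + l i}) :
      f ⟨0, hm0⟩ = g.1 ⟨0, hm0⟩ := hlead f (hf _)
  have hqK : q ^ g.1 ⟨0, hm0⟩ ≠ 0 := (pow_pos hq.1 _).ne'
  rw [geomProb, geomProb, div_div_div_cancel_right₀ hZ.ne']
  rw [geomWeight_eq_card_mul_pow q n m hm0 _ (g.1 ⟨0, hm0⟩) hleadl,
    geomWeight_eq_card_mul_pow q n m hm0 _ (g.1 ⟨0, hm0⟩) hlead,
    huniq, ← Nat.card_congr e, mul_div_mul_right _ _ hqK, Nat.cast_one]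
end

section
/- Fix q ∈ (0,1) and set λ = −log q > 0. For each n, let m = m_n be a sequence of positive integers with m_n → ∞ and m_n = o(n^{1/3}), and let κ = (k₁,…,k_m) ∈ 𝒫_n(m) be chosen with probability P(κ) = c·q^{k₁}, where c is the normalizing constant. Then (1/√m)·(k₁ − ⌈n/m⌉ − γm) converges weakly as n → ∞ to the normal distribution N(0, σ²), where γ = (1/λ²)·∫₀^λ t/(e^t − 1) dt and σ² = (2/λ³)·∫₀^λ t/(e^t − 1) dt − 1/(λ(e^λ − 1)) > 0. -/
open scoped BigOperators

open MeasureTheory ProbabilityTheory Filter Topology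

/-- The weight `∑ (M - j) d_j` on the gaps `d` of a partition. -/
def gapWeight {M : ℕ} (d : Fin M → ℕ) : ℕ := ∑ j, ((j.rev : ℕ) + 1) * d j

/-- Independent geometric gaps, the one of weight `k` having ratio `z ^ k`. -/
noncomputable def gapMeasure (z : unitInterval) (M : ℕ) : Measure (Fin M → ℕ) :=
  Measure.pi fun j => geometricMeasure (unitInterval.symm (z ^ ((j.rev : ℕ) + 1)))

instance (z : unitInterval) (M : ℕ) : IsProbabilityMeasure (gapMeasure z M) := by
  unfold gapMeasure; infer_instance

/-- The probability generating function of `gapWeight` under `gapMeasure z M`. -/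
noncomputable def gapGen (z : ℝ) (M : ℕ) (w : ℂ) : ℂ :=
  ∏ j ∈ Finset.range M, (1 - (z : ℂ) ^ (j + 1)) / (1 - ((z : ℂ) * w) ^ (j + 1))

lemma symm_pow_ne_zero {z : unitInterval} (hz : (z : ℝ) < 1) (k : ℕ) :
    unitInterval.symm (z ^ (k + 1)) ≠ 0 := by
  intro h
  have h1 : (1 : ℝ) - (z : ℝ) ^ (k + 1) = 0 := by
    simpa using congrArg (Subtype.val) h
  have := pow_lt_one₀ z.2.1 hz (Nat.succ_ne_zero k)
  simp only [Nat.succ_eq_add_one] at this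
  linarith

lemma integral_pow_geometric {z : unitInterval} (hz : (z : ℝ) < 1) (k : ℕ) {w : ℂ}
    (hw : ‖w‖ ≤ 1) :
    ∫ x, (w ^ (k + 1)) ^ x ∂(geometricMeasure (unitInterval.symm (z ^ (k + 1)))) =
      (1 - ((z : ℝ) : ℂ) ^ (k + 1)) / (1 - (((z : ℝ) : ℂ) * w) ^ (k + 1)) := by
  rw [integral_geometricMeasure (symm_pow_ne_zero hz k)]
  have hzn : ‖(((z : ℝ) : ℂ) * w) ^ (k + 1)‖ < 1 := by
    rw [norm_pow]
    refine pow_lt_one₀ (norm_nonneg _) ?_ (Nat.succ_ne_zero k)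
    rw [norm_mul, Complex.norm_real, Real.norm_of_nonneg z.2.1]
    nlinarith [z.2.1, norm_nonneg w]
  rw [div_eq_mul_inv, ← tsum_geometric_of_norm_lt_one hzn, ← tsum_mul_left]
  congr 1 with x
  simp only [unitInterval.coe_symm_eq, Complex.real_smul]
  push_cast
  ring

lemma integral_pow_gapWeight {z : unitInterval} (hz : (z : ℝ) < 1) (M : ℕ) {w : ℂ}
    (hw : ‖w‖ ≤ 1) :
    ∫ d, w ^ gapWeight d ∂(gapMeasure z M) = gapGen z M w := by
  have h (d : Fin M → ℕ) : w ^ gapWeight d = ∏ j, (w ^ ((j.rev : ℕ) + 1)) ^ d j := by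
    simp_rw [gapWeight, ← pow_mul, Finset.prod_pow_eq_pow_sum]
  simp_rw [h]
  rw [gapMeasure, integral_fintype_prod_eq_prod (𝕜 := ℂ)
    (fun (j : Fin M) (x : ℕ) => (w ^ ((j.rev : ℕ) + 1)) ^ x)]
  simp_rw [integral_pow_geometric hz _ hw]
  rw [gapGen, Finset.prod_range]
  exact Equiv.prod_comp Fin.revPerm (fun j : Fin M =>
    (1 - ((z : ℝ) : ℂ) ^ ((j : ℕ) + 1)) / (1 - (((z : ℝ) : ℂ) * w) ^ ((j : ℕ) + 1)))

lemma gapMeasure_real_singleton {z : unitInterval} (hz : (z : ℝ) < 1) {M : ℕ}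
    (d : Fin M → ℕ) :
    (gapMeasure z M).real {d} =
      (∏ j ∈ Finset.range M, (1 - (z : ℝ) ^ (j + 1))) * (z : ℝ) ^ gapWeight d := by
  rw [measureReal_def, gapMeasure, Measure.pi_singleton, ENNReal.toReal_prod]
  simp_rw [← measureReal_def, geometricMeasure_real_singleton (symm_pow_ne_zero hz _)]
  rw [Finset.prod_mul_distrib, mul_comm, Finset.prod_range]
  congr 1
  · simpa using Equiv.prod_comp Fin.revPerm (fun j : Fin M => 1 - (z : ℝ) ^ ((j : ℕ) + 1))
  · simp_rw [gapWeight, ← Finset.prod_pow_eq_pow_sum, pow_mul]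
    simp

lemma sum_partialSum {M : ℕ} (d : Fin M → ℕ) :
    ∑ i, Fin.partialSum d i = gapWeight d := by
  induction M with
  | zero => simp [gapWeight]
  | succ M ih =>
    have h (i : Fin (M + 1)) :
        Fin.partialSum d i.succ = d 0 + Fin.partialSum (Fin.tail d) i :=
      Fin.partialSum_succ' d i
    rw [Fin.sum_univ_succ, Finset.sum_congr rfl fun i _ => h i, Finset.sum_add_distrib, ih,
      gapWeight, gapWeight, Fin.sum_univ_succ fun j : Fin (M + 1) => ((j.rev : ℕ) + 1) * d j]
    simp [Fin.rev_succ, Fin.tail, add_mul]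

/-- Gap sequences of the partitions of `n` into at most `M + 1` parts. -/
def gapSet (n M : ℕ) : Set (Fin M → ℕ) :=
  {d | M + 1 ∣ n + gapWeight d ∧ ∑ j, d j ≤ (n + gapWeight d) / (M + 1)}

lemma partialSum_mono {M : ℕ} (d : Fin M → ℕ) : Monotone (Fin.partialSum d) := by
  rw [Fin.monotone_iff_le_succ]
  intro i
  rw [Fin.partialSum_succ]
  exact Nat.le_add_right _ _

lemma partialSum_last {M : ℕ} (d : Fin M → ℕ) :
    Fin.partialSum d (Fin.last M) = ∑ j, d j := by
  induction M with
  | zero => simp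
  | succ M ih =>
    rw [← Fin.succ_last, Fin.partialSum_succ', ih, Fin.sum_univ_succ]; rfl

lemma partialSum_le {M : ℕ} (d : Fin M → ℕ) (i : Fin (M + 1)) :
    Fin.partialSum d i ≤ ∑ j, d j :=
  partialSum_last d ▸ partialSum_mono d (Fin.le_last i)

lemma geomWeight_eq {z : unitInterval} (hz : (z : ℝ) < 1) {q : ℝ} {n M : ℕ}
    (hq : (z : ℝ) ^ (M + 1) = q) (hm : 0 < M + 1) (S : Set ℕ) :
    (∏ j ∈ Finset.range M, (1 - (z : ℝ) ^ (j + 1))) *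
      geomWeight q n (M + 1) hm {f | f ⟨0, hm⟩ ∈ S} =
    (z : ℝ) ^ n * (gapMeasure z M).real
      (gapSet n M ∩ {d | (n + gapWeight d) / (M + 1) ∈ S}) := by
  set T := gapSet n M ∩ {d | (n + gapWeight d) / (M + 1) ∈ S} with hT
  have hg (d : T) : (Antitone (fun i => (n + gapWeight d.1) / (M + 1) - Fin.partialSum d.1 i) ∧
      ∑ i, ((n + gapWeight d.1) / (M + 1) - Fin.partialSum d.1 i) = n) ∧
      (fun i => (n + gapWeight d.1) / (M + 1) - Fin.partialSum d.1 i) ∈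
        {f : Fin (M + 1) → ℕ | f ⟨0, hm⟩ ∈ S} := by
    obtain ⟨d, ⟨⟨L, hL⟩, h2⟩, h3⟩ := d
    simp only [hL, Nat.mul_div_cancel_left L hm, Set.mem_ofPred_eq] at h2 h3 ⊢
    refine ⟨⟨fun i j hij => Nat.sub_le_sub_left (partialSum_mono d hij) _, ?_⟩, ?_⟩
    · have : ∑ i, (L - Fin.partialSum d i) + ∑ i, Fin.partialSum d i = (M + 1) * L := by
        rw [← Finset.sum_add_distrib, Finset.sum_congr rfl fun i _ =>
          Nat.sub_add_cancel ((partialSum_le d i).trans h2)]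
        simp
      rw [sum_partialSum] at this
      omega
    · simpa [Fin.partialSum_zero] using h3
  let e : T → {g : Fin (M + 1) → ℕ // (Antitone g ∧ ∑ i, g i = n) ∧
      g ∈ {f : Fin (M + 1) → ℕ | f ⟨0, hm⟩ ∈ S}} := fun d => ⟨_, hg d⟩
  have he : Function.Bijective e := by
    constructor
    · rintro ⟨d, hd⟩ ⟨d', hd'⟩ h
      have h1 (i) := congrFun (congrArg Subtype.val h) i
      simp only [e] at h1
      have h0 := h1 0
      simp only [Fin.partialSum_zero, Nat.sub_zero] at h0
      have h2 (i) : Fin.partialSum d i = Fin.partialSum d' i := by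
        have := h1 i
        have a1 := (partialSum_le d i).trans hd.1.2
        have a2 := (partialSum_le d' i).trans hd'.1.2
        omega
      ext j
      have a1 := h2 j.succ
      have a2 := h2 j.castSucc
      rw [Fin.partialSum_succ, Fin.partialSum_succ] at a1
      simp only at *
      omega
    · rintro ⟨g, ⟨ha, hs⟩, hS⟩
      have hps (i) : Fin.partialSum (fun j : Fin M => g j.castSucc - g j.succ) i = g 0 - g i := by
        induction i using Fin.induction with
        | zero => simp
        | succ i ih =>
          rw [Fin.partialSum_succ, ih]
          have := ha (Fin.zero_le i.castSucc)
          have := ha (Fin.castSucc_lt_succ (i := i)).le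
          omega
      have hw : n + gapWeight (fun j : Fin M => g j.castSucc - g j.succ) = (M + 1) * g 0 := by
        rw [← sum_partialSum, ← hs, ← Finset.sum_add_distrib,
          Finset.sum_congr rfl fun i _ => by
            rw [hps, Nat.add_sub_cancel' (ha (Fin.zero_le i))]]
        simp
      have hsum : ∑ j : Fin M, (g j.castSucc - g j.succ) ≤ g 0 := by
        rw [← partialSum_last, hps]; exact Nat.sub_le _ _
      refine ⟨⟨fun j => g j.castSucc - g j.succ, ⟨⟨g 0, hw⟩, ?_⟩, ?_⟩, ?_⟩
      · rwa [hw, Nat.mul_div_cancel_left _ hm]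
      · simp only [Set.mem_ofPred_eq]; rwa [hw, Nat.mul_div_cancel_left _ hm]
      · refine Subtype.ext (funext fun i => ?_)
        simp only [e]
        rw [hw, Nat.mul_div_cancel_left _ hm, hps, Nat.sub_sub_self (ha (Fin.zero_le i))]
  have hPT : (gapMeasure z M).real T = ∑' d : T, (gapMeasure z M).real {d.1} := by
    have h := measureReal_def (gapMeasure z M) T
    rw [h, ← Set.preimage_id (s := T), ← tsum_measure_preimage_singleton T.to_countable
      (fun _ _ => (Set.to_countable _).measurableSet), ENNReal.tsum_toReal_eq (by simp)]
    rfl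
  rw [geomWeight, ← (Equiv.ofBijective e he).tsum_eq, hPT, ← tsum_mul_left, ← tsum_mul_left]
  refine tsum_congr fun d => ?_
  rw [gapMeasure_real_singleton hz]
  have : (Equiv.ofBijective e he d).1 ⟨0, hm⟩ = (n + gapWeight d.1) / (M + 1) := by
    change (n + gapWeight d.1) / (M + 1) - Fin.partialSum d.1 0 = _
    simp
  rw [this, ← hq, ← pow_mul, Nat.mul_div_cancel' d.2.1.1, pow_add]
  ring

lemma norm_one_sub_div_sq_le {ρ q : ℝ} (hq : 0 ≤ q) (hqρ : q ≤ ρ) (hρ : ρ < 1) {u : ℂ}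
    (hu : ‖u‖ = 1) :
    ‖(1 - (ρ : ℂ)) / (1 - ρ * u)‖ ^ 2 ≤ Real.exp (-(2 * q / 5 * (1 - u.re))) := by
  have hu2 : u.re * u.re + u.im * u.im = 1 := by
    rw [← Complex.normSq_apply, Complex.normSq_eq_norm_sq, hu, one_pow]
  have hre : |u.re| ≤ 1 := hu ▸ Complex.abs_re_le_norm u
  obtain ⟨h1, h2⟩ := abs_le.mp hre
  set c := 1 - u.re with hc
  have hden : ‖1 - ρ * u‖ ^ 2 = (1 - ρ) ^ 2 + 2 * ρ * c := by
    rw [← Complex.normSq_eq_norm_sq, Complex.normSq_apply]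
    simp only [Complex.sub_re, Complex.one_re, Complex.mul_re, Complex.ofReal_re,
      Complex.ofReal_im, Complex.sub_im, Complex.one_im, Complex.mul_im]
    linear_combination ρ ^ 2 * hu2
  have hnum : ‖(1 - (ρ : ℂ))‖ ^ 2 = (1 - ρ) ^ 2 := by
    rw [← Complex.ofReal_one, ← Complex.ofReal_sub, Complex.norm_real, Real.norm_eq_abs, sq_abs]
  rw [norm_div, div_pow, hden, hnum]
  have hρ0 : 0 ≤ ρ := hq.trans hqρ
  have hA : 0 < (1 - ρ) ^ 2 := by nlinarith
  have hc0 : 0 ≤ c := by linarith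
  have hpos : 0 < (1 - ρ) ^ 2 + 2 * ρ * c := by positivity
  rw [div_le_iff₀ hpos]
  have hexp := Real.add_one_le_exp (-(2 * q / 5 * c))
  have hA1 : (1 - ρ) ^ 2 ≤ 1 := by nlinarith
  have hx : 2 * q / 5 * c ≤ 4 / 5 := by nlinarith
  have hx0 : 0 ≤ 2 * q / 5 * c := by positivity
  have e1 : 2 * q / 5 * c ≤ 2 * ρ * c / 5 := by nlinarith
  calc (1 - ρ) ^ 2 ≤ (-(2 * q / 5 * c) + 1) * ((1 - ρ) ^ 2 + 2 * ρ * c) := by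
        nlinarith [mul_nonneg hx0 (sub_nonneg.2 hA1),
          mul_nonneg (mul_nonneg hρ0 hc0) (sub_nonneg.2 hx)]
    _ ≤ _ := by gcongr

lemma norm_gapGen_le {z q : ℝ} (hz0 : 0 < z) (hz : z < 1) {M : ℕ} (hq : z ^ (M + 1) = q)
    {w : ℂ} (hw : ‖w‖ = 1) {s : ℝ} (hs : s ≤ ∑ j ∈ Finset.range M, (1 - (w ^ (j + 1)).re)) :
    ‖gapGen z M w‖ ≤ Real.exp (-(q / 5 * s)) := by
  have hq0 : 0 < q := hq ▸ pow_pos hz0 _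
  have h : ‖gapGen z M w‖ ^ 2 ≤ Real.exp (-(q / 5 * s)) ^ 2 := by
    rw [gapGen, norm_prod, ← Finset.prod_pow, ← Real.exp_nat_mul]
    calc _ ≤ ∏ j ∈ Finset.range M, Real.exp (-(2 * q / 5 * (1 - (w ^ (j + 1)).re))) := by
          refine Finset.prod_le_prod (fun _ _ => by positivity) fun j hj => ?_
          have := norm_one_sub_div_sq_le (ρ := z ^ (j + 1)) (u := w ^ (j + 1)) hq0.le
            (hq ▸ pow_le_pow_of_le_one hz0.le hz.le
              (Nat.succ_le_succ (Finset.mem_range.1 hj).le))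
            (pow_lt_one₀ hz0.le hz (Nat.succ_ne_zero j)) (by rw [norm_pow, hw, one_pow])
          rw [mul_pow]
          simpa using this
      _ ≤ _ := by
          rw [← Real.exp_sum, Finset.sum_neg_distrib, ← Finset.mul_sum]
          gcongr
          push_cast
          nlinarith
  exact (sq_le_sq₀ (norm_nonneg _) (Real.exp_pos _).le).1 h

lemma sum_pow_eq_zero_of_isPrimitiveRoot {M : ℕ} {ω : ℂ} (hω : IsPrimitiveRoot ω (M + 1))
    {N : ℕ} (hN : ¬ M + 1 ∣ N) : ∑ k ∈ Finset.range (M + 1), (ω ^ N) ^ k = 0 := by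
  have h1 : ω ^ N ≠ 1 := fun h => hN ((hω.pow_eq_one_iff_dvd N).1 h)
  have h2 := mul_geom_sum (ω ^ N) (M + 1)
  rw [← pow_mul, mul_comm N, pow_mul, hω.pow_eq_one, one_pow, sub_self] at h2
  exact (mul_eq_zero.1 h2).resolve_left (sub_ne_zero.2 h1)

lemma norm_gapGen_root_mul_le {z q : ℝ} (hz0 : 0 < z) (hz : z < 1) {M : ℕ}
    (hq : z ^ (M + 1) = q) {ω : ℂ} (hω : IsPrimitiveRoot ω (M + 1)) {k : ℕ} (hk0 : k ≠ 0)
    (hk : k < M + 1) (θ : ℝ) :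
    ‖gapGen z M (ω ^ k * Complex.exp (Complex.I * θ))‖ ≤
      Real.exp (-(q / 5 * ((M + 1) * (1 - (M + 1) * |θ|)))) := by
  have hω1 : ‖ω‖ = 1 := hω.norm'_eq_one (Nat.succ_ne_zero M)
  have he (t : ℝ) : ‖Complex.exp (Complex.I * t)‖ = 1 := by
    rw [mul_comm, Complex.norm_exp_ofReal_mul_I]
  refine norm_gapGen_le hz0 hz hq (by rw [norm_mul, norm_pow, hω1, he]; simp) ?_
  have hsum : ∑ j ∈ Finset.range M, ((ω ^ k) ^ (j + 1)).re = -1 := by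
    have h := sum_pow_eq_zero_of_isPrimitiveRoot hω
      (fun hd => hk0 (Nat.eq_zero_of_dvd_of_lt hd hk))
    rw [Finset.sum_range_succ', pow_zero] at h
    rw [← Complex.re_sum, eq_neg_of_add_eq_zero_left h]
    simp
  have hj : ∀ j ∈ Finset.range M, 1 - ((ω ^ k) ^ (j + 1)).re - (M + 1) * |θ| ≤
      1 - ((ω ^ k * Complex.exp (Complex.I * θ)) ^ (j + 1)).re := by
    intro j hj
    have h1 : ‖(ω ^ k) ^ (j + 1) * (Complex.exp (Complex.I * ((j + 1 : ℝ) * θ : ℝ)) - 1)‖ ≤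
        (M + 1) * |θ| := by
      rw [norm_mul, norm_pow, norm_pow, hω1, one_pow, one_pow, one_mul]
      refine (Real.norm_exp_I_mul_ofReal_sub_one_le).trans ?_
      rw [norm_mul, Real.norm_eq_abs, Real.norm_eq_abs, abs_of_nonneg (by positivity)]
      gcongr
      exact (Finset.mem_range.1 hj).le
    have h2 := (Complex.re_le_norm _).trans h1
    have h3 : (ω ^ k * Complex.exp (Complex.I * θ)) ^ (j + 1) = (ω ^ k) ^ (j + 1) *
        (Complex.exp (Complex.I * ((j + 1 : ℝ) * θ : ℝ)) - 1) + (ω ^ k) ^ (j + 1) := by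
      rw [mul_pow, ← Complex.exp_nat_mul]
      push_cast
      ring_nf
    rw [h3, Complex.add_re]
    linarith
  refine le_trans ?_ (Finset.sum_le_sum hj)
  rw [Finset.sum_sub_distrib, Finset.sum_sub_distrib, hsum]
  simp only [Finset.sum_const, Finset.card_range, nsmul_eq_mul, mul_one]
  nlinarith [abs_nonneg θ, (Nat.cast_nonneg M : (0 : ℝ) ≤ M)]

/-- Gap sequences of weight congruent to `-n` modulo `M + 1`. -/
def residueSet (n M : ℕ) : Set (Fin M → ℕ) := {d | M + 1 ∣ n + gapWeight d}

lemma norm_setIntegral_sub_gapGen_le {z : unitInterval} {q : ℝ} (hz0 : 0 < (z : ℝ))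
    (hz : (z : ℝ) < 1) {M : ℕ} (hq : (z : ℝ) ^ (M + 1) = q) (n : ℕ) (θ : ℝ) :
    ‖(M + 1) * ∫ d in residueSet n M, Complex.exp (Complex.I * θ) ^ gapWeight d
        ∂(gapMeasure z M) - gapGen z M (Complex.exp (Complex.I * θ))‖ ≤
      M * Real.exp (-(q / 5 * ((M + 1) * (1 - (M + 1) * |θ|)))) := by
  set ω := Complex.exp (2 * Real.pi * Complex.I / ((M + 1 : ℕ) : ℂ)) with hωdef
  have hω : IsPrimitiveRoot ω (M + 1) := Complex.isPrimitiveRoot_exp _ (Nat.succ_ne_zero M)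
  have hω1 : ‖ω‖ = 1 := hω.norm'_eq_one (Nat.succ_ne_zero M)
  set ζ := Complex.exp (Complex.I * θ) with hζ
  have hζ1 : ‖ζ‖ = 1 := by rw [hζ, mul_comm, Complex.norm_exp_ofReal_mul_I]
  have hind (d : Fin M → ℕ) : (M + 1) * (residueSet n M).indicator (fun d => ζ ^ gapWeight d) d =
      ∑ k ∈ Finset.range (M + 1), (ω ^ k) ^ n * (ω ^ k * ζ) ^ gapWeight d := by
    have h1 : ∑ k ∈ Finset.range (M + 1), (ω ^ k) ^ n * (ω ^ k * ζ) ^ gapWeight d =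
        (∑ k ∈ Finset.range (M + 1), (ω ^ (n + gapWeight d)) ^ k) * ζ ^ gapWeight d := by
      rw [Finset.sum_mul]
      refine Finset.sum_congr rfl fun k _ => ?_
      ring
    rw [h1]
    by_cases hd : M + 1 ∣ n + gapWeight d
    · rw [Set.indicator_of_mem (show d ∈ residueSet n M from hd),
        (hω.pow_eq_one_iff_dvd _).2 hd]
      simp
    · rw [Set.indicator_of_notMem (show d ∉ residueSet n M from hd),
        sum_pow_eq_zero_of_isPrimitiveRoot hω hd]
      simp
  have hnorm (k : ℕ) : ‖ω ^ k * ζ‖ = 1 := by rw [norm_mul, norm_pow, hω1, hζ1]; simp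
  have hint : (M + 1) * ∫ d in residueSet n M, ζ ^ gapWeight d ∂(gapMeasure z M) =
      ∑ k ∈ Finset.range (M + 1), (ω ^ k) ^ n * gapGen z M (ω ^ k * ζ) := by
    rw [← integral_indicator (Set.to_countable _).measurableSet, ← integral_const_mul]
    simp_rw [hind]
    rw [integral_finsetSum]
    · refine Finset.sum_congr rfl fun k _ => ?_
      rw [integral_const_mul, integral_pow_gapWeight hz M (hnorm k).le]
    · intro k _
      refine Integrable.of_bound (C := 1) (Measurable.of_discrete).aestronglyMeasurable
        (ae_of_all _ fun d => ?_)
      rw [norm_mul, norm_pow, norm_pow, norm_pow, hω1, hnorm]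
      simp
  rw [hint, Finset.sum_range_succ']
  simp only [pow_zero, one_pow, one_mul, add_sub_cancel_right]
  refine (norm_sum_le_of_le _ (fun k hk => ?_)).trans
    (by rw [Finset.sum_const, Finset.card_range, nsmul_eq_mul])
  rw [norm_mul, norm_pow, norm_pow, hω1, one_pow, one_pow, one_mul]
  exact norm_gapGen_root_mul_le hz0 hz hq hω (Nat.succ_ne_zero k)
    (Nat.succ_lt_succ (Finset.mem_range.1 hk)) θ

lemma riemann_sum_bounds {f : ℝ → ℝ} {l : ℝ} (hl : 0 < l) (hf : AntitoneOn f (Set.Ioc 0 l))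
    (h1 : ∀ x ∈ Set.Ioc 0 l, f x ≤ 1) (h0 : 0 ≤ f l) (M : ℕ) :
    ∑ j ∈ Finset.range M, f (l * (j + 1) / (M + 1)) ≤ (M + 1) / l * ∫ t in (0 : ℝ)..l, f t ∧
    (M + 1) / l * ∫ t in (0 : ℝ)..l, f t ≤
      ∑ j ∈ Finset.range M, f (l * (j + 1) / (M + 1)) + 1 := by
  set g : ℝ → ℝ := fun x => if x ≤ 0 then 1 else f (l * x / (M + 1)) with hg
  have hM : (0 : ℝ) < M + 1 := by positivity
  have hmem {x : ℝ} (hx0 : 0 < x) (hx : x ≤ M + 1) : l * x / (M + 1) ∈ Set.Ioc 0 l :=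
    ⟨by positivity, by rw [div_le_iff₀ hM]; gcongr⟩
  have hanti : AntitoneOn g (Set.Icc 0 (0 + ((M + 1 : ℕ) : ℝ))) := by
    intro x hx y hy hxy
    push_cast at hx hy
    rw [zero_add] at hx hy
    simp only [hg]
    split_ifs with h2 h3 h3
    · exact le_rfl
    · linarith
    · exact h1 _ (hmem (not_le.1 h2) hy.2)
    · exact hf (hmem (not_le.1 h3) hx.2) (hmem (not_le.1 h2) hy.2) (by gcongr)
  have hgs (j : ℕ) : g (j + 1) = f (l * (j + 1) / (M + 1)) := by
    have : ¬ ((j : ℝ) + 1 ≤ 0) := not_le.2 (by positivity)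
    simp only [hg, if_neg this]
  have hint : ∫ x in (0 : ℝ)..0 + ((M + 1 : ℕ) : ℝ), g x =
      (M + 1) / l * ∫ t in (0 : ℝ)..l, f t := by
    have h2 : ∫ x in (0 : ℝ)..0 + ((M + 1 : ℕ) : ℝ), g x =
        ∫ x in (0 : ℝ)..0 + ((M + 1 : ℕ) : ℝ), f (l / (M + 1) * x) := by
      refine intervalIntegral.integral_congr_ae (ae_of_all _ fun x hx => ?_)
      rw [Set.uIoc_of_le (by positivity)] at hx
      simp only [hg, if_neg (not_le.2 hx.1)]
      congr 1; ring
    rw [h2, intervalIntegral.integral_comp_mul_left _ (by positivity), smul_eq_mul]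
    push_cast
    rw [mul_zero, zero_add, div_mul_cancel₀ _ hM.ne', inv_div]
  have hlo := hanti.sum_le_integral
  have hhi := hanti.integral_le_sum
  rw [hint] at hlo hhi
  simp only [zero_add, Nat.cast_add, Nat.cast_one, hgs] at hlo hhi
  constructor
  · rw [Finset.sum_range_succ] at hlo
    have : l * ((M : ℝ) + 1) / (M + 1) = l := by field_simp
    rw [this] at hlo
    linarith
  · rw [Finset.sum_range_succ'] at hhi
    simp only [Nat.cast_add, Nat.cast_one, hgs, Nat.cast_zero] at hhi
    simpa [hg] using hhi

lemma exp_sub_one_pos {t : ℝ} (ht : 0 < t) : 0 < Real.exp t - 1 :=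
  sub_pos.2 (Real.one_lt_exp_iff.2 ht)

lemma antitoneOn_div_exp_sub_one :
    AntitoneOn (fun t : ℝ => t / (Real.exp t - 1)) (Set.Ioi 0) := by
  intro x hx y hy hxy
  have h := convexOn_exp.secant_mono (Set.mem_univ 0) (Set.mem_univ x) (Set.mem_univ y)
    (ne_of_gt hx) (ne_of_gt hy) hxy
  simp only [Real.exp_zero, sub_zero] at h
  have := inv_anti₀ (div_pos (exp_sub_one_pos hx) hx) h
  simpa [inv_div] using this

lemma div_exp_sub_one_le_one {t : ℝ} (ht : 0 < t) : t / (Real.exp t - 1) ≤ 1 := by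
  rw [div_le_one (exp_sub_one_pos ht)]
  linarith [Real.add_one_le_exp t]

lemma convexOn_sinh : ConvexOn ℝ (Set.Ici 0) Real.sinh := by
  refine convexOn_of_deriv2_nonneg (convex_Ici 0) Real.continuous_sinh.continuousOn
    Real.differentiable_sinh.differentiableOn (by simpa using Real.differentiable_cosh.differentiableOn) ?_
  intro x hx
  rw [interior_Ici] at hx
  simpa [Function.iterate_succ] using (Real.sinh_nonneg_iff.2 (le_of_lt hx))

lemma sq_mul_exp_div_eq {t : ℝ} :
    t ^ 2 * Real.exp t / (Real.exp t - 1) ^ 2 = (t / 2 / Real.sinh (t / 2)) ^ 2 := by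
  have h : Real.exp t = Real.exp (t / 2) ^ 2 := by rw [← Real.exp_nat_mul]; congr 1; push_cast; ring
  have h' : 2 * Real.sinh (t / 2) * Real.exp (t / 2) = Real.exp t - 1 := by
    rw [Real.sinh_eq, Real.exp_neg, h]
    field_simp
  rw [← h', h, mul_pow, mul_div_mul_right _ _ (by positivity)]
  ring

lemma antitoneOn_sq_mul_exp_div :
    AntitoneOn (fun t : ℝ => t ^ 2 * Real.exp t / (Real.exp t - 1) ^ 2) (Set.Ioi 0) := by
  intro x hx y hy hxy
  simp only [sq_mul_exp_div_eq]
  rw [Set.mem_Ioi] at hx hy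
  have hx2 : 0 < x / 2 := by positivity
  have hy2 : 0 < y / 2 := by positivity
  have h := convexOn_sinh.secant_mono (a := 0) (x := x / 2) (y := y / 2) Set.self_mem_Ici hx2.le
    hy2.le hx2.ne' hy2.ne' (by gcongr)
  simp only [Real.sinh_zero, sub_zero] at h
  have h2 := inv_anti₀ (div_pos (Real.sinh_pos_iff.2 hx2) hx2) h
  rw [inv_div, inv_div] at h2
  have := Real.sinh_pos_iff.2 hy2
  gcongr

lemma sq_mul_exp_div_le_one {t : ℝ} (ht : 0 < t) :
    t ^ 2 * Real.exp t / (Real.exp t - 1) ^ 2 ≤ 1 := by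
  have h2 : 0 < t / 2 := by positivity
  have := Real.sinh_pos_iff.2 h2
  rw [sq_mul_exp_div_eq]
  exact pow_le_one₀ (by positivity)
    ((div_le_one this).2 (Real.self_le_sinh_iff.2 h2.le))

lemma intervalIntegrable_of_antitoneOn {f : ℝ → ℝ} {l : ℝ} (hl : 0 < l)
    (hf : AntitoneOn f (Set.Ioi 0)) (h0 : ∀ x, 0 < x → 0 ≤ f x) (h1 : ∀ x, 0 < x → f x ≤ 1) :
    IntervalIntegrable f volume 0 l := by
  rw [intervalIntegrable_iff_integrableOn_Ioc_of_le hl.le]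
  have hf' := hf.mono (Set.Ioc_subset_Ioi_self : Set.Ioc (0 : ℝ) l ⊆ _)
  refine Integrable.of_bound (C := 1)
    (aemeasurable_restrict_of_antitoneOn measurableSet_Ioc hf').aestronglyMeasurable ?_
  refine (ae_restrict_iff' measurableSet_Ioc).2 (ae_of_all _ fun x hx => ?_)
  rw [Real.norm_of_nonneg (h0 x hx.1)]
  exact h1 x hx.1

lemma integral_sq_mul_exp_div {l : ℝ} (hl : 0 < l) :
    ∫ t in (0 : ℝ)..l, t ^ 2 * Real.exp t / (Real.exp t - 1) ^ 2 =
      2 * (∫ t in (0 : ℝ)..l, t / (Real.exp t - 1)) - l ^ 2 / (Real.exp l - 1) := by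
  have iG : IntervalIntegrable (fun t : ℝ => t / (Real.exp t - 1)) volume 0 l :=
    intervalIntegrable_of_antitoneOn hl antitoneOn_div_exp_sub_one
      (fun x hx => (div_pos hx (exp_sub_one_pos hx)).le) fun x hx => div_exp_sub_one_le_one hx
  have iH : IntervalIntegrable (fun t : ℝ => t ^ 2 * Real.exp t / (Real.exp t - 1) ^ 2)
      volume 0 l :=
    intervalIntegrable_of_antitoneOn hl antitoneOn_sq_mul_exp_div
      (fun x hx => by positivity) fun x hx => sq_mul_exp_div_le_one hx
  have hcont : ContinuousOn (fun t : ℝ => t ^ 2 / (Real.exp t - 1)) (Set.Icc 0 l) := by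
    intro x hx
    rcases hx.1.eq_or_lt with rfl | hx0
    · rw [ContinuousWithinAt]
      simp only [ne_eq, OfNat.ofNat_ne_zero, not_false_eq_true, zero_pow, zero_div]
      refine squeeze_zero' ?_ ?_ (tendsto_id.mono_left nhdsWithin_le_nhds)
      · filter_upwards [self_mem_nhdsWithin] with t ht
        exact div_nonneg (sq_nonneg t) (sub_nonneg.2 (Real.one_le_exp ht.1))
      · filter_upwards [self_mem_nhdsWithin] with t ht
        rcases ht.1.eq_or_lt with rfl | ht0
        · simp
        · have := mul_le_mul_of_nonneg_left (div_exp_sub_one_le_one ht0) ht.1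
          rw [pow_two, mul_div_assoc]
          simpa using this
    · have hden : ContinuousAt (fun t : ℝ => Real.exp t - 1) x := by fun_prop
      exact ((continuousAt_id.pow 2).div hden (exp_sub_one_pos hx0).ne').continuousWithinAt
  have hder : ∀ x ∈ Set.Ioo (0 : ℝ) l, HasDerivAt (fun t : ℝ => t ^ 2 / (Real.exp t - 1))
      (2 * (x / (Real.exp x - 1)) - x ^ 2 * Real.exp x / (Real.exp x - 1) ^ 2) x := by
    intro x hx
    have hne := (exp_sub_one_pos hx.1).ne'
    convert! (hasDerivAt_pow 2 x).div ((Real.hasDerivAt_exp x).sub_const 1) hne using 1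
    field_simp
    ring
  have h := intervalIntegral.integral_eq_sub_of_hasDerivAt_of_le hl.le hcont hder
    ((iG.const_mul 2).sub iH)
  rw [intervalIntegral.integral_sub (iG.const_mul 2) iH,
    intervalIntegral.integral_const_mul] at h
  simp at h
  linarith

lemma integral_sq_mul_exp_div_pos {l : ℝ} (hl : 0 < l) :
    0 < ∫ t in (0 : ℝ)..l, t ^ 2 * Real.exp t / (Real.exp t - 1) ^ 2 := by
  refine intervalIntegral.intervalIntegral_pos_of_pos_on ?_ (fun x hx => ?_) hl
  · exact intervalIntegrable_of_antitoneOn hl antitoneOn_sq_mul_exp_div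
      (fun x hx => by positivity) fun x hx => sq_mul_exp_div_le_one hx
  · have := exp_sub_one_pos hx.1
    have := hx.1
    positivity

lemma norm_exp_I_sub_sub_le {u : ℝ} (hu : |u| ≤ 1) :
    ‖Complex.exp (Complex.I * u) - 1 - Complex.I * u‖ ≤ |u| ^ 2 := by
  have h : ‖Complex.I * (u : ℂ)‖ = |u| := by simp
  simpa only [h] using Complex.norm_exp_sub_one_sub_id_le (x := Complex.I * u) (by rwa [h])

lemma norm_exp_I_sub_taylor_le {u : ℝ} (hu : |u| ≤ 1) :
    ‖Complex.exp (Complex.I * u) - 1 - Complex.I * u + (u : ℂ) ^ 2 / 2‖ ≤ |u| ^ 3 := by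
  have hn : ‖Complex.I * (u : ℂ)‖ = |u| := by simp
  have h := Complex.exp_bound (x := Complex.I * u) (by rwa [hn]) (n := 3) (by norm_num)
  rw [hn] at h
  simp only [Finset.sum_range_succ, Finset.sum_range_zero] at h
  norm_num [Nat.factorial, mul_pow, Complex.I_sq] at h
  have e : Complex.exp (Complex.I * u) - 1 - Complex.I * u + (u : ℂ) ^ 2 / 2 =
      Complex.exp (Complex.I * u) - (1 + Complex.I * u + -(u : ℂ) ^ 2 / 2) := by ring
  rw [e]
  refine h.trans ?_
  nlinarith [pow_nonneg (abs_nonneg u) 3]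

/-- Second order expansion of the logarithm of a geometric characteristic function. -/
lemma exists_inv_one_sub_eq_exp {a u ε : ℝ} (ha : 0 ≤ a) (hu : |u| ≤ ε) (hau : a * |u| ≤ ε)
    (hε : ε ≤ 1 / 2) :
    ∃ R : ℂ, ‖R‖ ≤ 5 * ε ^ 3 ∧ (1 - a * (Complex.exp (Complex.I * u) - 1))⁻¹ =
      Complex.exp (Complex.I * (a * u : ℝ) - ((u ^ 2 * (a + a ^ 2) / 2 : ℝ) : ℂ) + R) := by
  set E := Complex.exp (Complex.I * u) - 1 with hE
  set w := (a : ℂ) * E with hw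
  have hε0 : 0 ≤ ε := (abs_nonneg u).trans hu
  have hu1 : |u| ≤ 1 := by linarith
  have hEn : ‖E‖ ≤ |u| := by
    simpa using Real.norm_exp_I_mul_ofReal_sub_one_le (x := u)
  have hwn : ‖w‖ ≤ ε := by
    rw [hw, norm_mul, Complex.norm_real, Real.norm_of_nonneg ha]
    exact (mul_le_mul_of_nonneg_left hEn ha).trans hau
  have hw1 : ‖w‖ < 1 := by linarith
  have hne : 1 - w ≠ 0 := by
    intro h
    rw [← sub_eq_zero.1 h] at hw1
    simp at hw1
  have e1 : ‖Complex.log (1 - w)⁻¹ - (w + w ^ 2 / 2)‖ ≤ ε ^ 3 := by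
    have h := Complex.norm_log_one_sub_inv_add_logTaylor_neg_le 2 hw1
    have hT : Complex.logTaylor (2 + 1) (-w) = -(w + w ^ 2 / 2) := by
      simp [Complex.logTaylor_succ, Complex.logTaylor_zero]
      ring
    rw [hT, ← sub_eq_add_neg] at h
    refine h.trans ?_
    have h2 : (1 - ‖w‖)⁻¹ ≤ 2 := by
      rw [inv_le_comm₀ (by linarith) two_pos]; linarith
    have h3 : ‖w‖ ^ 3 ≤ ε ^ 3 := by gcongr
    have h4 : ‖w‖ ^ 3 * (1 - ‖w‖)⁻¹ ≤ ε ^ 3 * 2 := by gcongr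
    norm_num
    nlinarith [pow_nonneg hε0 3]
  have e2 : ‖w - (Complex.I * (a * u : ℝ) - ((a * u ^ 2 / 2 : ℝ) : ℂ))‖ ≤ ε ^ 3 := by
    have : w - (Complex.I * (a * u : ℝ) - ((a * u ^ 2 / 2 : ℝ) : ℂ)) =
        a * (Complex.exp (Complex.I * u) - 1 - Complex.I * u + (u : ℂ) ^ 2 / 2) := by
      rw [hw, hE]; push_cast; ring
    rw [this, norm_mul, Complex.norm_real, Real.norm_of_nonneg ha]
    calc a * _ ≤ a * |u| ^ 3 := by gcongr; exact norm_exp_I_sub_taylor_le hu1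
      _ = (a * |u|) * |u| ^ 2 := by ring
      _ ≤ ε * ε ^ 2 := by gcongr
      _ = ε ^ 3 := by ring
  have e3 : ‖w ^ 2 + ((a ^ 2 * u ^ 2 : ℝ) : ℂ)‖ ≤ 2 * ε ^ 3 := by
    have : w ^ 2 + ((a ^ 2 * u ^ 2 : ℝ) : ℂ) = a ^ 2 * ((E - Complex.I * u) *
        (E + Complex.I * u)) := by
      rw [hw]; push_cast; linear_combination (a : ℂ) ^ 2 * u ^ 2 * Complex.I_sq
    rw [this, norm_mul, norm_pow, norm_mul, Complex.norm_real, Real.norm_of_nonneg ha]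
    have h2 : ‖E + Complex.I * u‖ ≤ 2 * |u| := by
      refine (norm_add_le _ _).trans ?_
      have : ‖Complex.I * (u : ℂ)‖ = |u| := by simp
      linarith
    calc _ ≤ a ^ 2 * (|u| ^ 2 * (2 * |u|)) := by
          gcongr; exact norm_exp_I_sub_sub_le hu1
      _ = 2 * ((a * |u|) ^ 2 * |u|) := by ring
      _ ≤ 2 * (ε ^ 2 * ε) := by gcongr
      _ = 2 * ε ^ 3 := by ring
  refine ⟨Complex.log (1 - w)⁻¹ -
    (Complex.I * (a * u : ℝ) - ((u ^ 2 * (a + a ^ 2) / 2 : ℝ) : ℂ)), ?_, ?_⟩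
  · have : Complex.log (1 - w)⁻¹ -
        (Complex.I * (a * u : ℝ) - ((u ^ 2 * (a + a ^ 2) / 2 : ℝ) : ℂ)) =
        (Complex.log (1 - w)⁻¹ - (w + w ^ 2 / 2)) +
        (w - (Complex.I * (a * u : ℝ) - ((a * u ^ 2 / 2 : ℝ) : ℂ))) +
        (1 / 2 : ℂ) * (w ^ 2 + ((a ^ 2 * u ^ 2 : ℝ) : ℂ)) := by
      push_cast; ring
    rw [this]
    refine (norm_add₃_le).trans ?_
    have h5 : ‖(1 / 2 : ℂ) * (w ^ 2 + ((a ^ 2 * u ^ 2 : ℝ) : ℂ))‖ ≤ 2 * ε ^ 3 := by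
      rw [norm_mul]; norm_num; norm_num at e3
      nlinarith [norm_nonneg (w ^ 2 + (a : ℂ) ^ 2 * (u : ℂ) ^ 2)]
    nlinarith [pow_nonneg hε0 3]
  · rw [add_sub_cancel, Complex.exp_log (inv_ne_zero hne)]

/-- Gaussian limit of the generating function along the circle of radius one, with angle
`t / (M + 1) ^ (3 / 2)`. -/
lemma tendsto_gapGen {l : ℝ} (hl : 0 < l) (t : ℝ) :
    Tendsto (fun M : ℕ => gapGen (Real.exp (-(l / (M + 1)))) M
        (Complex.exp (Complex.I * (t / ((M + 1) * √(M + 1)) : ℝ))) *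
      Complex.exp (-(Complex.I * ((1 / l ^ 2 * ∫ s in (0 : ℝ)..l, s / (Real.exp s - 1)) *
        √(M + 1) * t : ℝ)))) atTop
      (𝓝 (Complex.exp (-((t ^ 2 / 2 * (1 / l ^ 3 *
        ∫ s in (0 : ℝ)..l, s ^ 2 * Real.exp s / (Real.exp s - 1) ^ 2) : ℝ) : ℂ)))) := by
  set I := ∫ s in (0 : ℝ)..l, s / (Real.exp s - 1) with hI
  set J := ∫ s in (0 : ℝ)..l, s ^ 2 * Real.exp s / (Real.exp s - 1) ^ 2 with hJ
  set C := |t| * (1 + 1 / l) with hC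
  have hC0 : 0 ≤ C := by positivity
  have hM1 : Tendsto (fun M : ℕ => ((M : ℝ) + 1)) atTop atTop :=
    tendsto_atTop_add_const_right _ _ tendsto_natCast_atTop_atTop
  have hsq : Tendsto (fun M : ℕ => √((M : ℝ) + 1)) atTop atTop :=
    Real.tendsto_sqrt_atTop.comp hM1
  have hε : ∀ᶠ M : ℕ in atTop, C / √((M : ℝ) + 1) ≤ 1 / 2 :=
    ((tendsto_const_nhds.div_atTop hsq).eventually (ge_mem_nhds (by norm_num)))
  -- the exponent, up to a vanishing error
  have key : ∀ᶠ M : ℕ in atTop, ∃ R : ℂ, ‖R‖ ≤ (5 * C ^ 3 + |t| / l) / √((M : ℝ) + 1) +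
        t ^ 2 / (2 * l ^ 2) / (M + 1) ∧
      gapGen (Real.exp (-(l / (M + 1)))) M
        (Complex.exp (Complex.I * (t / ((M + 1) * √(M + 1)) : ℝ))) *
      Complex.exp (-(Complex.I * ((1 / l ^ 2 * I) * √(M + 1) * t : ℝ))) =
      Complex.exp (-((t ^ 2 / 2 * (1 / l ^ 3 * J) : ℝ) : ℂ) + R) := by
    filter_upwards [hε] with M hM
    set m : ℝ := (M : ℝ) + 1 with hm
    have hm0 : 0 < m := by positivity
    set r := √m with hr
    have hr0 : 0 < r := Real.sqrt_pos.2 hm0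
    have hr2 : r ^ 2 = m := Real.sq_sqrt hm0.le
    set θ := t / (m * r) with hθ
    set x : ℕ → ℝ := fun j => l * (j + 1) / m with hx
    have hx0 (j) : 0 < x j := by positivity
    set a : ℕ → ℝ := fun j => 1 / (Real.exp (x j) - 1) with ha
    have ha0 (j) : 0 ≤ a j := (one_div_pos.2 (exp_sub_one_pos (hx0 j))).le
    have hu (j) (hj : j ∈ Finset.range M) : |(j + 1) * θ| ≤ C / r := by
      have : (j : ℝ) + 1 ≤ m := by
        rw [hm]; gcongr; exact (Finset.mem_range.1 hj).le
      rw [abs_mul, hθ, abs_div, abs_of_pos (by positivity : (0 : ℝ) < j + 1),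
        abs_of_pos (mul_pos hm0 hr0)]
      calc (j + 1 : ℝ) * (|t| / (m * r)) ≤ m * (|t| / (m * r)) := by gcongr
        _ = |t| / r := by field_simp
        _ ≤ C / r := by
          gcongr
          rw [hC, mul_add, mul_one]
          have : 0 ≤ |t| * (1 / l) := by positivity
          linarith
    have hau (j) (hj : j ∈ Finset.range M) : a j * |(j + 1) * θ| ≤ C / r := by
      have h1 : a j ≤ 1 / x j := by
        simp only [ha]
        exact one_div_le_one_div_of_le (hx0 j) (by linarith [Real.add_one_le_exp (x j)])
      rw [abs_mul, hθ, abs_div, abs_of_pos (by positivity : (0 : ℝ) < j + 1),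
        abs_of_pos (mul_pos hm0 hr0)]
      calc a j * ((j + 1 : ℝ) * (|t| / (m * r))) ≤ 1 / x j * ((j + 1 : ℝ) * (|t| / (m * r))) := by
            gcongr
        _ = |t| * (1 / l) / r := by simp only [hx]; field_simp
        _ ≤ C / r := by gcongr; rw [hC]; gcongr; linarith
    have hex (j : ℕ) : ∃ R : ℂ, j ∈ Finset.range M → (‖R‖ ≤ 5 * (C / r) ^ 3 ∧
        (1 - a j * (Complex.exp (Complex.I * ((j + 1) * θ : ℝ)) - 1))⁻¹ =
        Complex.exp (Complex.I * (a j * ((j + 1) * θ) : ℝ) -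
          ((((j + 1) * θ) ^ 2 * (a j + a j ^ 2) / 2 : ℝ) : ℂ) + R)) := by
      by_cases hj : j ∈ Finset.range M
      · obtain ⟨R, h⟩ := exists_inv_one_sub_eq_exp (ha0 j) (hu j hj) (hau j hj) hM
        exact ⟨R, fun _ => h⟩
      · exact ⟨0, fun h => absurd h hj⟩
    choose R hR using hex
    have hfac (j : ℕ) : (1 - ((Real.exp (-(l / m)) : ℝ) : ℂ) ^ (j + 1)) /
        (1 - (((Real.exp (-(l / m)) : ℝ) : ℂ) * Complex.exp (Complex.I * θ)) ^ (j + 1)) =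
        (1 - a j * (Complex.exp (Complex.I * ((j + 1) * θ : ℝ)) - 1))⁻¹ := by
      have h1 : ((Real.exp (-(l / m)) : ℝ) : ℂ) ^ (j + 1) = ((Real.exp (x j) : ℝ) : ℂ)⁻¹ := by
        rw [← Complex.ofReal_pow, ← Real.exp_nat_mul, ← Complex.ofReal_inv, ← Real.exp_neg]
        congr 2; simp only [hx]; push_cast; ring
      have h2 : Complex.exp (Complex.I * θ) ^ (j + 1) =
          Complex.exp (Complex.I * ((j + 1) * θ : ℝ)) := by
        rw [← Complex.exp_nat_mul]; congr 1; push_cast; ring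
      rw [mul_pow, h1, h2]
      have h3 : ((Real.exp (x j) : ℝ) : ℂ) - 1 ≠ 0 := by
        rw [← Complex.ofReal_one, ← Complex.ofReal_sub]
        exact Complex.ofReal_ne_zero.2 (exp_sub_one_pos (hx0 j)).ne'
      have h4 : ((Real.exp (x j) : ℝ) : ℂ) ≠ 0 := Complex.ofReal_ne_zero.2 (Real.exp_pos _).ne'
      have h5 : ((a j : ℝ) : ℂ) = 1 / (((Real.exp (x j) : ℝ) : ℂ) - 1) := by
        simp only [ha]; push_cast; rfl
      rw [h5]
      generalize ((Real.exp (x j) : ℝ) : ℂ) = y at h3 h4 ⊢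
      generalize Complex.exp (Complex.I * ((j + 1) * θ : ℝ)) = v
      have h6 : 1 - 1 / (y - 1) * (v - 1) = (1 - y⁻¹ * v) / (1 - y⁻¹) := by
        have : 1 - y⁻¹ ≠ 0 := by
          intro h; apply h3; rw [inv_eq_one.1 (sub_eq_zero.1 h).symm, sub_self]
        field_simp
        ring
      rw [h6, inv_div]
    have hgen : gapGen (Real.exp (-(l / m))) M (Complex.exp (Complex.I * θ)) =
        Complex.exp (∑ j ∈ Finset.range M, (Complex.I * (a j * ((j + 1) * θ) : ℝ) -
          ((((j + 1) * θ) ^ 2 * (a j + a j ^ 2) / 2 : ℝ) : ℂ) + R j)) := by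
      rw [gapGen, Complex.exp_sum]
      exact Finset.prod_congr rfl fun j hj => (hfac j).trans (hR j hj).2
    have hG := riemann_sum_bounds hl (antitoneOn_div_exp_sub_one.mono Set.Ioc_subset_Ioi_self)
      (fun x hx => div_exp_sub_one_le_one hx.1) (div_pos hl (exp_sub_one_pos hl)).le M
    have hH := riemann_sum_bounds hl (antitoneOn_sq_mul_exp_div.mono Set.Ioc_subset_Ioi_self)
      (fun x hx => sq_mul_exp_div_le_one hx.1) (by positivity) M
    rw [← hm, ← hI] at hG
    rw [← hm, ← hJ] at hH
    set SG := ∑ j ∈ Finset.range M, l * (j + 1) / m / (Real.exp (l * (j + 1) / m) - 1) with hSG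
    set SH := ∑ j ∈ Finset.range M, (l * (j + 1) / m) ^ 2 * Real.exp (l * (j + 1) / m) /
      (Real.exp (l * (j + 1) / m) - 1) ^ 2 with hSH
    have hs1 : ∑ j ∈ Finset.range M, a j * ((j + 1) * θ) = t / (l * r) * SG := by
      rw [hSG, Finset.mul_sum]
      refine Finset.sum_congr rfl fun j _ => ?_
      simp only [ha, hx, hθ]
      have := (exp_sub_one_pos (hx0 j)).ne'
      simp only [hx] at this
      field_simp
    have hs2 : ∑ j ∈ Finset.range M, ((j + 1) * θ) ^ 2 * (a j + a j ^ 2) / 2 =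
        t ^ 2 / (2 * l ^ 2 * m) * SH := by
      rw [hSH, Finset.mul_sum]
      refine Finset.sum_congr rfl fun j _ => ?_
      rw [mul_pow, hθ, div_pow, mul_pow m, hr2]
      simp only [ha, hx]
      have := (exp_sub_one_pos (hx0 j)).ne'
      simp only [hx] at this
      field_simp
      ring
    refine ⟨Complex.I * (t / (l * r) * (SG - m / l * I) : ℝ) -
      ((t ^ 2 / (2 * l ^ 2 * m) * (SH - m / l * J) : ℝ) : ℂ) + ∑ j ∈ Finset.range M, R j,
      ?_, ?_⟩
    · have b1 : ‖Complex.I * ((t / (l * r) * (SG - m / l * I) : ℝ) : ℂ)‖ ≤ |t| / l / r := by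
        rw [norm_mul, Complex.norm_I, one_mul, Complex.norm_real, Real.norm_eq_abs, abs_mul,
          abs_div, abs_of_pos (mul_pos hl hr0), div_div]
        exact mul_le_of_le_one_right (by positivity)
          (abs_le.2 ⟨by linarith [hG.2], by linarith [hG.1]⟩)
      have b2 : ‖((t ^ 2 / (2 * l ^ 2 * m) * (SH - m / l * J) : ℝ) : ℂ)‖ ≤
          t ^ 2 / (2 * l ^ 2) / m := by
        rw [Complex.norm_real, Real.norm_eq_abs, abs_mul, abs_of_nonneg (by positivity), div_div]
        exact mul_le_of_le_one_right (by positivity)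
          (abs_le.2 ⟨by linarith [hH.2], by linarith [hH.1]⟩)
      have b3 : ‖∑ j ∈ Finset.range M, R j‖ ≤ 5 * C ^ 3 / r := by
        refine (norm_sum_le_of_le _ fun j hj => (hR j hj).1).trans ?_
        rw [Finset.sum_const, Finset.card_range, nsmul_eq_mul]
        calc (M : ℝ) * (5 * (C / r) ^ 3) ≤ m * (5 * (C / r) ^ 3) := by gcongr; linarith
          _ = 5 * C ^ 3 / r := by rw [← hr2]; field_simp
      have b4 := norm_sub_le (Complex.I * ((t / (l * r) * (SG - m / l * I) : ℝ) : ℂ))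
        ((t ^ 2 / (2 * l ^ 2 * m) * (SH - m / l * J) : ℝ) : ℂ)
      exact ((norm_add_le _ _).trans (add_le_add (b4.trans (add_le_add b1 b2)) b3)).trans
        (le_of_eq (by ring))
    · rw [hgen, ← Complex.exp_add]
      congr 1
      rw [Finset.sum_add_distrib, Finset.sum_sub_distrib, ← Finset.mul_sum,
        ← Complex.ofReal_sum, ← Complex.ofReal_sum, hs1, hs2]
      have c1 : 1 / l ^ 2 * I * r * t = t / (l * r) * (m / l * I) := by
        rw [← hr2]; field_simp
      have c2 : t ^ 2 / 2 * (1 / l ^ 3 * J) = t ^ 2 / (2 * l ^ 2 * m) * (m / l * J) := by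
        field_simp
      rw [c1, c2]
      push_cast
      ring
  have hbound : Tendsto (fun M : ℕ => (5 * C ^ 3 + |t| / l) / √((M : ℝ) + 1) +
        t ^ 2 / (2 * l ^ 2) / ((M : ℝ) + 1)) atTop (𝓝 0) := by
    simpa using (tendsto_const_nhds.div_atTop hsq).add (tendsto_const_nhds.div_atTop hM1)
  obtain ⟨R, hR⟩ := key.choice
  have hR0 : Tendsto R atTop (𝓝 0) :=
    squeeze_zero_norm' (hR.mono fun M h => h.1) hbound
  have hlim := (Complex.continuous_exp.tendsto _).comp
    ((tendsto_const_nhds (x := -((t ^ 2 / 2 * (1 / l ^ 3 * J) : ℝ) : ℂ))).add hR0)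
  rw [add_zero] at hlim
  exact hlim.congr' (hR.mono fun M h => h.2.symm)

lemma exp_neg_div_pow (l : ℝ) (M : ℕ) :
    Real.exp (-(l / (M + 1))) ^ (M + 1) = Real.exp (-l) := by
  rw [← Real.exp_nat_mul]
  congr 1
  push_cast
  field_simp

lemma tendsto_mul_setIntegral_residueSet {l : ℝ} (hl : 0 < l) {M : ℕ → ℕ}
    (hM : Tendsto M atTop atTop) {z : ℕ → unitInterval}
    (hz : ∀ n, (z n : ℝ) = Real.exp (-(l / (M n + 1)))) (t : ℝ) :
    Tendsto (fun n => (M n + 1) * (∫ d in residueSet n (M n),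
        Complex.exp (Complex.I * (t / ((M n + 1) * √(M n + 1)) : ℝ)) ^ gapWeight d
          ∂(gapMeasure (z n) (M n))) *
      Complex.exp (-(Complex.I * ((1 / l ^ 2 * ∫ s in (0 : ℝ)..l, s / (Real.exp s - 1)) *
        √(M n + 1) * t : ℝ)))) atTop
      (𝓝 (Complex.exp (-((t ^ 2 / 2 * (1 / l ^ 3 *
        ∫ s in (0 : ℝ)..l, s ^ 2 * Real.exp s / (Real.exp s - 1) ^ 2) : ℝ) : ℂ)))) := by
  set γ := 1 / l ^ 2 * ∫ s in (0 : ℝ)..l, s / (Real.exp s - 1)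
  have hM' : Tendsto (fun n => (M n : ℝ) + 1) atTop atTop :=
    tendsto_atTop_add_const_right _ _ (tendsto_natCast_atTop_atTop.comp hM)
  have hq : 0 < Real.exp (-l) / 10 := by positivity
  have hbound : Tendsto (fun n => ((M n : ℝ) + 1) *
      Real.exp (-(Real.exp (-l) / 10 * ((M n : ℝ) + 1)))) atTop (𝓝 0) := by
    have := (tendsto_rpow_mul_exp_neg_mul_atTop_nhds_zero 1 _ hq).comp hM'
    refine this.congr fun n => ?_
    simp
  have hdiff : Tendsto (fun n => ((M n + 1) * (∫ d in residueSet n (M n),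
        Complex.exp (Complex.I * (t / ((M n + 1) * √(M n + 1)) : ℝ)) ^ gapWeight d
          ∂(gapMeasure (z n) (M n))) - gapGen (z n) (M n)
          (Complex.exp (Complex.I * (t / ((M n + 1) * √(M n + 1)) : ℝ)))) *
      Complex.exp (-(Complex.I * (γ * √(M n + 1) * t : ℝ)))) atTop (𝓝 0) := by
    refine squeeze_zero_norm' ?_ hbound
    filter_upwards [hM'.eventually_ge_atTop (4 * t ^ 2)] with n hn
    have hs : (0 : ℝ) < M n + 1 := by positivity
    have hz1 : (z n : ℝ) < 1 := by
      rw [hz, Real.exp_lt_one_iff]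
      have := div_pos hl hs
      linarith
    have hexp : ‖Complex.exp (-(Complex.I * (γ * √(M n + 1) * t : ℝ)))‖ = 1 := by
      rw [Complex.norm_exp]
      simp
    rw [norm_mul, hexp, mul_one]
    refine (norm_setIntegral_sub_gapGen_le (q := Real.exp (-l))
      (by rw [hz]; positivity) hz1 (by rw [hz]; exact exp_neg_div_pow l (M n)) n _).trans ?_
    refine mul_le_mul (by linarith) ?_ (Real.exp_nonneg _) hs.le
    refine Real.exp_le_exp.2 (neg_le_neg ?_)
    have hθ : ((M n : ℝ) + 1) * |t / ((M n + 1) * √(M n + 1))| ≤ 1 / 2 := by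
      have hsq : (0 : ℝ) < √(M n + 1) := Real.sqrt_pos.2 hs
      rw [abs_div, abs_of_pos (mul_pos hs hsq), ← mul_div_assoc, mul_div_mul_left _ _ hs.ne',
        div_le_iff₀ hsq]
      have : 2 * |t| ≤ √(M n + 1) := Real.le_sqrt_of_sq_le (by rw [mul_pow, sq_abs]; linarith)
      linarith
    have hge : ((M n : ℝ) + 1) * (1 / 2) ≤
        (M n + 1) * (1 - (M n + 1) * |t / ((M n + 1) * √(M n + 1))|) :=
      mul_le_mul_of_nonneg_left (by linarith) hs.le
    have := mul_le_mul_of_nonneg_left hge (by positivity : 0 ≤ Real.exp (-l) / 5)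
    linarith
  have hgen := (tendsto_gapGen hl t).comp hM
  rw [← zero_add (Complex.exp _)]
  refine (hdiff.add hgen).congr fun n => ?_
  simp only [Function.comp_apply, hz]
  ring

/-- The gap vectors realising the residue condition have positive probability. -/
lemma gapMeasure_residueSet_ne_zero {z : unitInterval} (hz0 : 0 < (z : ℝ)) (hz : (z : ℝ) < 1)
    (n M : ℕ) : gapMeasure z M (residueSet n M) ≠ 0 := by
  obtain ⟨d, hd⟩ : ∃ d, d ∈ residueSet n M := by
    rcases M with _ | M
    · exact ⟨0, by simp [residueSet]⟩
    · refine ⟨Pi.single (Fin.last M) (n * (M + 1)), ?_⟩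
      have : gapWeight (Pi.single (Fin.last M) (n * (M + 1))) = n * (M + 1) := by
        rw [gapWeight, Finset.sum_eq_single (Fin.last M)]
        · simp
        · intro b _ hb
          simp [hb]
        · simp
      rw [residueSet, Set.mem_ofPred_eq, this]
      exact ⟨n, by ring⟩
  have hpos : 0 < (gapMeasure z M).real {d} := by
    rw [gapMeasure_real_singleton hz]
    refine mul_pos (Finset.prod_pos fun j _ => ?_) (by positivity)
    have := pow_lt_one₀ hz0.le hz (Nat.succ_ne_zero j)
    simpa using this
  intro h
  have := measure_mono_null (Set.singleton_subset_iff.2 hd) h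
  simp [measureReal_def, this] at hpos

/-- The centred and rescaled value of `(n + gapWeight d) / (M + 1)`. -/
noncomputable def scaledPart (γ c : ℝ) (n : ℕ) {M : ℕ} (d : Fin M → ℕ) : ℝ :=
  ((n + gapWeight d : ℝ) / (M + 1) - c - γ * (M + 1)) / √(M + 1)

lemma exp_mul_scaledPart (γ c : ℝ) (n : ℕ) {M : ℕ} (d : Fin M → ℕ) (t : ℝ) :
    Complex.exp (t * scaledPart γ c n d * Complex.I) =
      Complex.exp (Complex.I * (t / ((M + 1) * √(M + 1)) : ℝ)) ^ gapWeight d *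
      (Complex.exp (-(Complex.I * (γ * √(M + 1) * t : ℝ))) *
        Complex.exp (Complex.I * (t * ((n / (M + 1) - c) / √(M + 1)) : ℝ))) := by
  have hs : (0 : ℝ) < M + 1 := by positivity
  have hsq : (0 : ℝ) < √(M + 1) := Real.sqrt_pos.2 hs
  rw [← Complex.exp_nat_mul, ← Complex.exp_add, ← Complex.exp_add]
  congr 1
  have : t * scaledPart γ c n d = gapWeight d * (t / ((M + 1) * √(M + 1))) -
      γ * √(M + 1) * t + t * ((n / (M + 1) - c) / √(M + 1)) := by
    rw [scaledPart]
    field_simp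
    rw [Real.sq_sqrt hs.le]
    ring
  calc (t * scaledPart γ c n d * Complex.I : ℂ)
      = ((t * scaledPart γ c n d : ℝ) : ℂ) * Complex.I := by push_cast; ring
    _ = _ := by rw [this]; push_cast; ring

lemma tendsto_cond_scaledPart {l : ℝ} (hl : 0 < l) {M : ℕ → ℕ}
    (hM : Tendsto M atTop atTop) {z : ℕ → unitInterval}
    (hz : ∀ n, (z n : ℝ) = Real.exp (-(l / (M n + 1)))) {c : ℕ → ℝ}
    (hc : ∀ n : ℕ, |(n : ℝ) / (M n + 1) - c n| ≤ 1) {v : NNReal} (hv0 : v ≠ 0)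
    (hv : (v : ℝ) =
      1 / l ^ 3 * ∫ s in (0 : ℝ)..l, s ^ 2 * Real.exp s / (Real.exp s - 1) ^ 2) (x : ℝ) :
    Tendsto (fun n => (gapMeasure (z n) (M n)).real (residueSet n (M n) ∩
        {d | scaledPart (1 / l ^ 2 * ∫ s in (0 : ℝ)..l, s / (Real.exp s - 1)) (c n) n d ≤ x}) /
        (gapMeasure (z n) (M n)).real (residueSet n (M n))) atTop
      (𝓝 ((gaussianReal 0 v).real (Set.Iic x))) := by
  have hlim := tendsto_mul_setIntegral_residueSet hl hM hz
  set γ := 1 / l ^ 2 * ∫ s in (0 : ℝ)..l, s / (Real.exp s - 1)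
  have hM' : Tendsto (fun n => (M n : ℝ) + 1) atTop atTop :=
    tendsto_atTop_add_const_right _ _ (tendsto_natCast_atTop_atTop.comp hM)
  have hz0 (n : ℕ) : 0 < (z n : ℝ) := by rw [hz]; positivity
  have hz1 (n : ℕ) : (z n : ℝ) < 1 := by
    rw [hz, Real.exp_lt_one_iff]
    have : 0 < l / ((M n : ℝ) + 1) := by positivity
    linarith
  have hA (n : ℕ) := gapMeasure_residueSet_ne_zero (hz0 n) (hz1 n) n (M n)
  have hAr (n : ℕ) : (gapMeasure (z n) (M n)).real (residueSet n (M n)) ≠ 0 := by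
    rw [measureReal_def]
    exact (ENNReal.toReal_pos (hA n) (measure_ne_top _ _)).ne'
  have (n : ℕ) : IsProbabilityMeasure ((gapMeasure (z n) (M n))[|residueSet n (M n)]) :=
    cond_isProbabilityMeasure (hA n)
  have hmeas (n : ℕ) : Measurable (fun d : Fin (M n) → ℕ => scaledPart γ (c n) n d) :=
    Measurable.of_discrete
  let ν (n : ℕ) : ProbabilityMeasure ℝ :=
    ⟨((gapMeasure (z n) (M n))[|residueSet n (M n)]).map (scaledPart γ (c n) n),
      Measure.isProbabilityMeasure_map (hmeas n).aemeasurable⟩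
  have hchar (n : ℕ) (t : ℝ) : charFun (ν n : Measure ℝ) t =
      (((M n : ℂ) + 1) * (∫ d in residueSet n (M n),
        Complex.exp (Complex.I * (t / ((M n + 1) * √(M n + 1)) : ℝ)) ^ gapWeight d
          ∂(gapMeasure (z n) (M n))) * Complex.exp (-(Complex.I * (γ * √(M n + 1) * t : ℝ)))) *
        Complex.exp (Complex.I * (t * ((n / (M n + 1) - c n) / √(M n + 1)) : ℝ)) /
        (((M n : ℂ) + 1) * (gapMeasure (z n) (M n)).real (residueSet n (M n))) := by
    rw [charFun_apply_real]
    change ∫ y, _ ∂(Measure.map _ _) = _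
    rw [integral_map (hmeas n).aemeasurable (by fun_prop)]
    simp_rw [exp_mul_scaledPart]
    rw [integral_mul_const, ProbabilityTheory.cond, integral_smul_measure]
    have h1 : ((M n : ℂ) + 1) ≠ 0 := by exact_mod_cast Nat.succ_ne_zero (M n)
    have h2 : ((gapMeasure (z n) (M n)).real (residueSet n (M n)) : ℂ) ≠ 0 := by
      exact_mod_cast hAr n
    rw [ENNReal.toReal_inv, ← measureReal_def, Complex.real_smul, Complex.ofReal_inv]
    field_simp
  have hδ (t : ℝ) : Tendsto (fun n => Complex.exp (Complex.I *
      (t * ((n / (M n + 1) - c n) / √(M n + 1)) : ℝ))) atTop (𝓝 1) := by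
    have h0 : Tendsto (fun n => t * ((n / ((M n : ℝ) + 1) - c n) / √(M n + 1))) atTop (𝓝 0) := by
      rw [← mul_zero t]
      refine Tendsto.const_mul t ?_
      refine squeeze_zero_norm (fun n => ?_)
        (tendsto_inv_atTop_zero.comp (Real.tendsto_sqrt_atTop.comp hM'))
      rw [norm_div, Real.norm_eq_abs, Real.norm_of_nonneg (Real.sqrt_nonneg _), div_eq_mul_inv]
      exact mul_le_of_le_one_left (by positivity) (hc n)
    have := ((Complex.continuous_ofReal.tendsto 0).comp h0).const_mul Complex.I
    simpa [Function.comp_def] using (Complex.continuous_exp.tendsto _).comp this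
  have hone : Tendsto (fun n => ((M n : ℂ) + 1) *
      (gapMeasure (z n) (M n)).real (residueSet n (M n))) atTop (𝓝 1) := by
    simpa [measureReal_def] using hlim 0
  have hconv : Tendsto ν atTop (𝓝 (⟨gaussianReal 0 v, inferInstance⟩ : ProbabilityMeasure ℝ)) := by
    refine ProbabilityMeasure.tendsto_of_tendsto_charFun fun t => ?_
    have hgauss : charFun (gaussianReal 0 v) t = Complex.exp (-((t ^ 2 / 2 * (1 / l ^ 3 *
        ∫ s in (0 : ℝ)..l, s ^ 2 * Real.exp s / (Real.exp s - 1) ^ 2) : ℝ) : ℂ)) * 1 / 1 := by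
      rw [charFun_gaussianReal, mul_one, div_one, ← hv]
      congr 1
      push_cast
      ring
    rw [ProbabilityMeasure.coe_mk, hgauss]
    simp_rw [hchar]
    exact ((hlim t).mul (hδ t)).div hone one_ne_zero
  have : NullSingletonClass (gaussianReal 0 v) := nullSingletonClass_gaussianReal hv0
  have hIic := ProbabilityMeasure.tendsto_measure_of_null_frontier_of_tendsto hconv
    (E := Set.Iic x) (by
      rw [frontier_Iic]
      exact (ProbabilityMeasure.null_iff_toMeasure_null _ _).2
        (measure_singleton (μ := gaussianReal 0 v) x))
  have hreal := (NNReal.continuous_coe.tendsto _).comp hIic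
  refine hreal.congr fun n => ?_
  change ((Measure.map _ _) (Set.Iic x)).toReal = _
  rw [Measure.map_apply (hmeas n) measurableSet_Iic,
    cond_apply (MeasurableSet.of_discrete), ENNReal.toReal_mul, ENNReal.toReal_inv]
  rw [← measureReal_def, ← measureReal_def, div_eq_inv_mul]
  rfl

lemma lt_scaledPart {γ c K : ℝ} {n M : ℕ} {d : Fin M → ℕ} (hc : c ≤ (n : ℝ) / (M + 1) + 1)
    (hn : (|γ| + 1 + |K|) * ((M : ℝ) + 1) ^ 3 ≤ n) (hd : d ∈ residueSet n M \ gapSet n M) :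
    K < scaledPart γ c n d := by
  obtain ⟨hA, hD⟩ := hd
  have hsum : ∑ j, d j ≤ gapWeight d :=
    Finset.sum_le_sum fun j _ => Nat.le_mul_of_pos_left _ (Nat.succ_pos _)
  have hlt : n < (M + 1) * gapWeight d := by
    have h1 : (n + gapWeight d) / (M + 1) < gapWeight d :=
      (not_le.1 fun h => hD ⟨hA, h⟩).trans_le hsum
    rw [Nat.div_lt_iff_lt_mul (Nat.succ_pos M)] at h1
    nlinarith
  have hlt' : (n : ℝ) < (M + 1) * gapWeight d := by exact_mod_cast hlt
  have hs : (1 : ℝ) ≤ M + 1 := by simp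
  set s : ℝ := M + 1
  have hs0 : 0 < s := by linarith
  have hsq : 0 < √s := Real.sqrt_pos.2 hs0
  have hss : √s ≤ s := Real.sqrt_le_iff.2 ⟨hs0.le, by nlinarith⟩
  have hw : (|γ| + 1 + |K|) * s < gapWeight d / s := by
    rw [lt_div_iff₀ hs0]
    have : (|γ| + 1 + |K|) * s * s * s < gapWeight d * s := by
      calc _ = (|γ| + 1 + |K|) * s ^ 3 := by ring
        _ ≤ n := hn
        _ < s * gapWeight d := hlt'
        _ = _ := mul_comm _ _
    exact lt_of_mul_lt_mul_right this hs0.le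
  rw [scaledPart, lt_div_iff₀ hsq, add_div]
  have h1 : K * √s ≤ |K| * s := by
    calc K * √s ≤ |K| * √s := by gcongr; exact le_abs_self K
      _ ≤ _ := by gcongr
  have h2 : γ * s ≤ |γ| * s := by gcongr; exact le_abs_self γ
  linarith

/-- Restricting to subsets carrying asymptotically all the mass does not affect
the limiting conditional distribution function. -/
lemma tendsto_div_measureReal_of_subset {Ω : ℕ → Type*} [∀ n, MeasurableSpace (Ω n)]
    [∀ n, DiscreteMeasurableSpace (Ω n)]
    {P : ∀ n, Measure (Ω n)} [∀ n, IsProbabilityMeasure (P n)] {A D : ∀ n, Set (Ω n)}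
    (hDA : ∀ n, D n ⊆ A n) (hA : ∀ n, (P n).real (A n) ≠ 0) {Y : ∀ n, Ω n → ℝ}
    {μ : Measure ℝ} [IsProbabilityMeasure μ]
    (hlim : ∀ x, Tendsto (fun n => (P n).real (A n ∩ {d | Y n d ≤ x}) / (P n).real (A n)) atTop
      (𝓝 (μ.real (Set.Iic x))))
    (htail : ∀ K, ∀ᶠ n in atTop, ∀ d ∈ A n \ D n, K < Y n d) (x : ℝ) :
    Tendsto (fun n => (P n).real (D n ∩ {d | Y n d ≤ x}) / (P n).real (D n)) atTop
      (𝓝 (μ.real (Set.Iic x))) := by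
  have hpos (n : ℕ) : 0 < (P n).real (A n) := measureReal_nonneg.lt_of_ne' (hA n)
  have he : Tendsto (fun n => (P n).real (A n \ D n) / (P n).real (A n)) atTop (𝓝 0) := by
    have hcdf : Tendsto (fun K => μ.real (Set.Iic K)) atTop (𝓝 1) :=
      (tendsto_cdf_atTop μ).congr (cdf_eq_real μ)
    refine (tendsto_order.2 ⟨fun a ha => Eventually.of_forall fun n => ha.trans_le
      (by positivity), fun ε hε => ?_⟩)
    obtain ⟨K, hK⟩ := ((tendsto_order.1 hcdf).1 (1 - ε) (by linarith)).exists
    filter_upwards [htail K, (tendsto_order.1 (hlim K)).1 _ hK] with n hn hF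
    have hle : (P n).real (A n \ D n) + (P n).real (A n ∩ {d | Y n d ≤ K}) ≤
        (P n).real (A n) := by
      rw [← measureReal_union _ MeasurableSet.of_discrete]
      · exact measureReal_mono (Set.union_subset Set.sdiff_subset Set.inter_subset_left)
      · exact Set.disjoint_left.2 fun d hd hd' => (hn d hd).not_ge hd'.2
    have := div_le_div_of_nonneg_right hle (hpos n).le
    rw [add_div, div_self (hA n)] at this
    linarith
  have hD : Tendsto (fun n => (P n).real (D n) / (P n).real (A n)) atTop (𝓝 1) := by
    rw [← sub_zero (1 : ℝ)]
    refine (he.const_sub 1).congr fun n => ?_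
    have := measureReal_sdiff_add_inter (μ := P n) (s := A n) (t := D n)
      (MeasurableSet.of_discrete)
    rw [Set.inter_eq_right.2 (hDA n)] at this
    rw [← div_self (hA n), ← sub_div, ← this, add_sub_cancel_left]
  have hnum : Tendsto (fun n => (P n).real (D n ∩ {d | Y n d ≤ x}) / (P n).real (A n)) atTop
      (𝓝 (μ.real (Set.Iic x))) := by
    refine tendsto_of_tendsto_of_tendsto_of_le_of_le
      (sub_zero (μ.real (Set.Iic x)) ▸ (hlim x).sub he) (hlim x) (fun n => ?_) fun n => ?_
    · simp only
      rw [← sub_div]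
      refine div_le_div_of_nonneg_right ?_ (hpos n).le
      rw [sub_le_iff_le_add]
      refine (measureReal_mono (fun d hd => ?_)).trans (measureReal_union_le _ _)
      by_cases h : d ∈ D n
      · exact Or.inl ⟨h, hd.2⟩
      · exact Or.inr ⟨hd.1, h⟩
    · exact div_le_div_of_nonneg_right
        (measureReal_mono (Set.inter_subset_inter_left _ (hDA n))) (hpos n).le
  rw [← div_one (μ.real (Set.Iic x))]
  refine (hnum.div hD one_ne_zero).congr fun n => ?_
  exact div_div_div_cancel_right₀ (hA n) _ _

lemma geomProb_eq {z : unitInterval} (hz0 : 0 < (z : ℝ)) (hz : (z : ℝ) < 1) {q : ℝ} {n M : ℕ}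
    (hq : (z : ℝ) ^ (M + 1) = q) (hm : 0 < M + 1) (S : Set ℕ) :
    geomProb q n (M + 1) hm {f | f ⟨0, hm⟩ ∈ S} = (gapMeasure z M).real
      (gapSet n M ∩ {d | (n + gapWeight d) / (M + 1) ∈ S}) /
        (gapMeasure z M).real (gapSet n M) := by
  have hC : (∏ j ∈ Finset.range M, (1 - (z : ℝ) ^ (j + 1))) ≠ 0 :=
    Finset.prod_ne_zero_iff.2 fun j _ =>
      (sub_pos.2 (pow_lt_one₀ hz0.le hz (Nat.succ_ne_zero j))).ne'
  have h1 := geomWeight_eq hz (n := n) hq hm S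
  have h2 := geomWeight_eq hz (n := n) hq hm Set.univ
  simp only [Set.mem_univ, Set.ofPred_true, Set.inter_univ] at h2
  rw [geomProb, ← mul_div_mul_left _ _ hC, h1, h2, mul_div_mul_left _ _ (pow_pos hz0 n).ne']

lemma gaussianReal_real_Iic {v : NNReal} (hv : v ≠ 0) (x : ℝ) :
    (gaussianReal 0 v).real (Set.Iic x) =
      (√(2 * Real.pi * v))⁻¹ * ∫ t in Set.Iic x, Real.exp (-(t ^ 2) / (2 * v)) := by
  rw [measureReal_def, gaussianReal_apply_eq_integral 0 hv, ENNReal.toReal_ofReal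
    (integral_nonneg fun t => gaussianPDFReal_nonneg 0 v t), ← integral_const_mul]
  simp [gaussianPDFReal]

/-- Central limit theorem for the largest part: if `m = m_n → ∞` with `m = o(n^{1/3})`,
then `(k₁ - ⌈n/m⌉ - γ m)/√m` converges weakly to `N(0, σ²)`, with `σ² > 0`. -/
theorem stmt_5 (q : ℝ) (hq : q ∈ Set.Ioo (0 : ℝ) 1) (lam : ℝ) (hlam : lam = -Real.log q)
    (m : ℕ → ℕ) (hm1 : ∀ n, 0 < m n)
    (hminf : Filter.Tendsto m Filter.atTop Filter.atTop)
    (hmo : (fun n => (m n : ℝ)) =o[Filter.atTop] fun n => (n : ℝ) ^ ((1 : ℝ) / 3))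
    (γ σ2 : ℝ)
    (hγ : γ = 1 / lam ^ 2 * ∫ t in (0 : ℝ)..lam, t / (Real.exp t - 1))
    (hσ : σ2 = 2 / lam ^ 3 * (∫ t in (0 : ℝ)..lam, t / (Real.exp t - 1)) -
      1 / (lam * (Real.exp lam - 1))) :
    0 < σ2 ∧
    ∀ x : ℝ, Filter.Tendsto
      (fun n : ℕ => geomProb q n (m n) (hm1 n)
        {f | ((f ⟨0, hm1 n⟩ : ℝ) - ((⌈(n : ℚ) / (m n : ℚ)⌉ : ℤ) : ℝ) - γ * (m n : ℝ)) /
          Real.sqrt (m n) ≤ x})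
      Filter.atTop
      (nhds ((Real.sqrt (2 * Real.pi * σ2))⁻¹ *
        ∫ t in Set.Iic x, Real.exp (-(t ^ 2) / (2 * σ2)))) := by
  have hl : 0 < lam := hlam ▸ neg_pos.2 (Real.log_neg hq.1 hq.2)
  have hql : q = Real.exp (-lam) := by rw [hlam, neg_neg, Real.exp_log hq.1]
  have hσJ : σ2 = 1 / lam ^ 3 *
      ∫ t in (0 : ℝ)..lam, t ^ 2 * Real.exp t / (Real.exp t - 1) ^ 2 := by
    have := exp_sub_one_pos hl
    rw [integral_sq_mul_exp_div hl, hσ]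
    field_simp
  have hσ0 : 0 < σ2 := hσJ ▸ mul_pos (by positivity) (integral_sq_mul_exp_div_pos hl)
  refine ⟨hσ0, fun x => ?_⟩
  obtain ⟨M, rfl⟩ : ∃ M : ℕ → ℕ, m = fun n => M n + 1 :=
    ⟨fun n => m n - 1, funext fun n => (Nat.sub_add_cancel (hm1 n)).symm⟩
  have hM : Tendsto M atTop atTop := tendsto_atTop.2 fun b =>
    (hminf.eventually_ge_atTop (b + 1)).mono fun n hn => Nat.le_of_succ_le_succ hn
  lift σ2 to NNReal using hσ0.le with v
  have hv0 : v ≠ 0 := fun h => hσ0.ne' (by simp [h])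
  have hmem (n : ℕ) : Real.exp (-(lam / (M n + 1))) ∈ Set.Ioo (0 : ℝ) 1 :=
    ⟨Real.exp_pos _, Real.exp_lt_one_iff.2 (neg_lt_zero.2 (by positivity))⟩
  let z (n : ℕ) : unitInterval := ⟨_, Set.Ioo_subset_Icc_self (hmem n)⟩
  have hzq (n : ℕ) : (z n : ℝ) ^ (M n + 1) = q := hql ▸ exp_neg_div_pow lam (M n)
  let c (n : ℕ) : ℝ := ((⌈(n : ℚ) / ((M n + 1 : ℕ) : ℚ)⌉ : ℤ) : ℝ)
  have hc (n : ℕ) : (n : ℝ) / (M n + 1) ≤ c n ∧ c n ≤ (n : ℝ) / (M n + 1) + 1 := by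
    have hceil (r : ℚ) : (r : ℝ) ≤ ⌈r⌉ ∧ (⌈r⌉ : ℝ) ≤ r + 1 :=
      ⟨by exact_mod_cast Int.le_ceil r, by exact_mod_cast (Int.ceil_lt_add_one r).le⟩
    have hcast : (((n : ℚ) / ((M n + 1 : ℕ) : ℚ) : ℚ) : ℝ) = n / (M n + 1) := by
      push_cast
      rfl
    exact hcast ▸ hceil _
  rw [← gaussianReal_real_Iic hv0]
  have hA (n : ℕ) : (gapMeasure (z n) (M n)).real (residueSet n (M n)) ≠ 0 :=
    (ENNReal.toReal_pos (gapMeasure_residueSet_ne_zero (hmem n).1 (hmem n).2 n (M n))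
      (measure_ne_top _ _)).ne'
  have hlim := tendsto_div_measureReal_of_subset (D := fun n => gapSet n (M n))
    (Y := fun n d => scaledPart γ (c n) n d) (fun n d hd => hd.1) hA
    (hγ ▸ tendsto_cond_scaledPart hl hM (z := z) (fun _ => rfl)
      (fun n => abs_le.2 ⟨by linarith [(hc n).2], by linarith [(hc n).1]⟩) hv0 hσJ)
    (fun K => ?_) x
  · refine hlim.congr fun n => ?_
    have hgeom := geomProb_eq (hmem n).1 (hmem n).2 (hzq n) (n := n) (hm1 n)
      {k | ((k : ℝ) - c n - γ * ((M n + 1 : ℕ) : ℝ)) / √((M n + 1 : ℕ) : ℝ) ≤ x}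
    refine Eq.trans ?_ hgeom.symm
    congr 2
    ext d
    refine and_congr_right fun hd => ?_
    change scaledPart γ (c n) n d ≤ x ↔ (((((n + gapWeight d) / (M n + 1) : ℕ) : ℝ)) - c n -
      γ * ((M n + 1 : ℕ) : ℝ)) / √((M n + 1 : ℕ) : ℝ) ≤ x
    rw [Nat.cast_div hd.1 (by positivity), scaledPart]
    push_cast
    rfl
  · have hB : (1 : ℝ) ≤ |γ| + 1 + |K| := by linarith [abs_nonneg γ, abs_nonneg K]
    set B := |γ| + 1 + |K|
    have hB0 : 0 < B := by linarith
    filter_upwards [Asymptotics.isLittleO_iff.1 hmo (inv_pos.2 hB0)] with n hn d hd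
    refine lt_scaledPart (hc n).2 ?_ hd
    rw [Real.norm_of_nonneg (by positivity), Real.norm_of_nonneg (by positivity)] at hn
    have hcube := pow_le_pow_left₀ (by positivity) hn 3
    rw [mul_pow, ← Real.rpow_natCast ((n : ℝ) ^ ((1 : ℝ) / 3)), ← Real.rpow_mul (by positivity)]
      at hcube
    norm_num at hcube
    calc B * ((M n : ℝ) + 1) ^ 3 ≤ B * ((B ^ 3)⁻¹ * n) := by gcongr
      _ = n / B ^ 2 := by field_simp
      _ ≤ n := div_le_self (by positivity) (one_le_pow₀ hB)
end

section
/- For u > 0 let v = v(u) > 0 be determined implicitly by u² = v² / ∫₀^v t/(e^t − 1) dt. Then for every u > 0 one has e^{v(u)} − 1 − u² > 0; in particular e^{v(u)} − 1 − u²/2 > 0. -/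
theorem div_exp_sub_one_lt {s t : ℝ} (hs : 0 < s) (hst : s < t) :
    t / (Real.exp t - 1) < s / (Real.exp s - 1) := by
  have hs' : 0 < Real.exp s - 1 := sub_pos.2 (Real.one_lt_exp_iff.2 hs)
  have ht' : 0 < Real.exp t - 1 := sub_pos.2 (Real.one_lt_exp_iff.2 (hs.trans hst))
  have h := strictConvexOn_exp.secant_strict_mono (Set.mem_univ 0) (Set.mem_univ s)
    (Set.mem_univ t) hs.ne' (hs.trans hst).ne' hst
  simp only [Real.exp_zero, sub_zero] at h
  rw [div_lt_div_iff₀ hs (hs.trans hst)] at h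
  rw [div_lt_div_iff₀ ht' hs']
  linarith

theorem intervalIntegrable_div_exp_sub_one {b : ℝ} (hb : 0 ≤ b) :
    IntervalIntegrable (fun t : ℝ => t / (Real.exp t - 1)) MeasureTheory.volume 0 b := by
  rw [intervalIntegrable_iff_integrableOn_Ioc_of_le hb]
  refine MeasureTheory.Measure.integrableOn_of_bounded (M := 1) measure_Ioc_lt_top.ne
    (Measurable.aestronglyMeasurable (by fun_prop)) ?_
  refine MeasureTheory.ae_restrict_of_forall_mem measurableSet_Ioc fun t ht => ?_
  have h : 0 < Real.exp t - 1 := sub_pos.2 (Real.one_lt_exp_iff.2 ht.1)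
  rw [Real.norm_of_nonneg (div_nonneg ht.1.le h.le), div_le_one h]
  linarith [Real.add_one_le_exp t]

theorem sq_div_exp_sub_one_lt_integral {b : ℝ} (hb : 0 < b) :
    b ^ 2 / (Real.exp b - 1) < ∫ t in (0 : ℝ)..b, t / (Real.exp t - 1) := by
  have hint := intervalIntegrable_div_exp_sub_one hb.le
  have hconst : IntervalIntegrable (fun _ : ℝ => b / (Real.exp b - 1))
      MeasureTheory.volume 0 b := intervalIntegrable_const
  have h := intervalIntegral.intervalIntegral_pos_of_pos_on (hint.sub hconst)
    (fun t ht => sub_pos.2 (div_exp_sub_one_lt ht.1 ht.2)) hb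
  rw [intervalIntegral.integral_sub hint hconst, intervalIntegral.integral_const, sub_zero,
    smul_eq_mul, ← mul_div_assoc, ← sq] at h
  exact sub_pos.1 h

/-- If `v = v(u) > 0` is determined by `u² = v² / ∫₀^v t/(eᵗ-1) dt`, then
`e^v - 1 - u² > 0`, and in particular `e^v - 1 - u²/2 > 0`. -/
theorem stmt_6 (v : ℝ → ℝ)
    (hv : ∀ u : ℝ, 0 < u → 0 < v u ∧
      u ^ 2 = (v u) ^ 2 / ∫ t in (0 : ℝ)..(v u), t / (Real.exp t - 1)) :
    ∀ u : ℝ, 0 < u →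
      0 < Real.exp (v u) - 1 - u ^ 2 ∧ 0 < Real.exp (v u) - 1 - u ^ 2 / 2 := by
  intro u hu
  obtain ⟨hb, huv⟩ := hv u hu
  have hexp : 0 < Real.exp (v u) - 1 := sub_pos.2 (Real.one_lt_exp_iff.2 hb)
  have hlt := sq_div_exp_sub_one_lt_integral hb
  have hpos := (div_pos (pow_pos hb 2) hexp).trans hlt
  have h : u ^ 2 < Real.exp (v u) - 1 := by
    rw [huv, div_lt_iff₀ hpos, mul_comm]
    exact (div_lt_iff₀ hexp).1 hlt
  constructor <;> linarith [pow_pos hu 2]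
end

section
/- For u > 0 let v = v(u) > 0 be determined implicitly by u² = v² / ∫₀^v t/(e^t − 1) dt, and define g(u) = 2v/u − u·log(1 − e^{−v}). Then g is twice differentiable on (0,∞) with g′(u) = −log(1 − e^{−v(u)}) and g″(u) = −(v/u) / (e^v − 1 − u²/2). -/
open Set Filter Topology in
/-- A function on `(0,∞)` with a strictly monotone left inverse `G` on the positive half-line that
takes values in `(0,∞)` is continuous. -/
lemma continuousAt_of_strictMonoOn_leftInverse {v G : ℝ → ℝ} (hG : StrictMonoOn G (Ioi 0))
    (hGpos : ∀ x, 0 < x → 0 < G x) (hvpos : ∀ u, 0 < u → 0 < v u)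
    (hGv : ∀ u, 0 < u → G (v u) = u) {u : ℝ} (hu : 0 < u) : ContinuousAt v u := by
  have hmono : StrictMonoOn v (Ioi 0) := by
    intro a ha b hb hab
    rw [← hG.lt_iff_lt (hvpos a ha) (hvpos b hb), hGv a ha, hGv b hb]
    exact hab
  refine hmono.continuousAt_of_image_mem_nhds (Ioi_mem_nhds hu) ?_
  refine mem_of_superset (Ioi_mem_nhds (hvpos u hu)) fun x hx => ?_
  have hGx := hGpos x hx
  exact ⟨G x, hGx, hG.injOn (hvpos _ hGx) hx (hGv _ hGx)⟩

lemma debye_integrand_nonneg {t : ℝ} (ht : 0 ≤ t) : 0 ≤ t / (Real.exp t - 1) :=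
  div_nonneg ht (sub_nonneg.2 (Real.one_le_exp ht))

lemma debye_integrand_le_one {t : ℝ} (ht : 0 ≤ t) : t / (Real.exp t - 1) ≤ 1 :=
  div_le_one_of_le₀ (by linarith [Real.add_one_le_exp t]) (sub_nonneg.2 (Real.one_le_exp ht))

lemma debye_integrand_antitone {t x : ℝ} (ht : 0 < t) (htx : t ≤ x) :
    x / (Real.exp x - 1) ≤ t / (Real.exp t - 1) := by
  have hx : 0 < x := ht.trans_le htx
  have h1 : 0 < Real.exp t - 1 := sub_pos.2 (Real.one_lt_exp_iff.2 ht)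
  have h2 : 0 < Real.exp x - 1 := sub_pos.2 (Real.one_lt_exp_iff.2 hx)
  have h := convexOn_exp.2 (Set.mem_univ x) (Set.mem_univ 0)
    (div_pos ht hx).le (sub_nonneg.2 ((div_le_one hx).2 htx)) (by ring)
  simp only [smul_eq_mul, mul_zero, add_zero, Real.exp_zero, mul_one] at h
  rw [div_mul_cancel₀ _ hx.ne'] at h
  rw [div_le_div_iff₀ h2 h1]
  have h3 : Real.exp t - 1 ≤ t / x * (Real.exp x - 1) := by linarith
  calc x * (Real.exp t - 1) ≤ x * (t / x * (Real.exp x - 1)) := by gcongr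
    _ = t * (Real.exp x - 1) := by field_simp

lemma debye_integrand_measurable : Measurable fun t : ℝ => t / (Real.exp t - 1) := by
  fun_prop

lemma debye_intervalIntegrable {x : ℝ} (hx : 0 ≤ x) :
    IntervalIntegrable (fun t : ℝ => t / (Real.exp t - 1)) MeasureTheory.volume 0 x := by
  refine (intervalIntegrable_const (c := (1 : ℝ))).mono_fun
    debye_integrand_measurable.aestronglyMeasurable ?_
  filter_upwards [MeasureTheory.ae_restrict_mem measurableSet_uIoc] with t ht
  rw [Set.uIoc_of_le hx] at ht
  rw [norm_one, Real.norm_of_nonneg (debye_integrand_nonneg ht.1.le)]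
  exact debye_integrand_le_one ht.1.le

lemma sq_div_le_debye_integral {x : ℝ} (hx : 0 < x) :
    x ^ 2 / (Real.exp x - 1) ≤ ∫ t in (0 : ℝ)..x, t / (Real.exp t - 1) := by
  have h := intervalIntegral.integral_mono_on_of_le_Ioo hx.le
    (intervalIntegrable_const (c := x / (Real.exp x - 1)) (μ := MeasureTheory.volume))
    (debye_intervalIntegrable hx.le)
    fun t ht => debye_integrand_antitone ht.1 ht.2.le
  rw [intervalIntegral.integral_const, smul_eq_mul, sub_zero] at h
  calc x ^ 2 / (Real.exp x - 1) = x * (x / (Real.exp x - 1)) := by ring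
    _ ≤ _ := h

lemma debye_integral_pos {x : ℝ} (hx : 0 < x) :
    0 < ∫ t in (0 : ℝ)..x, t / (Real.exp t - 1) := by
  have h : 0 < Real.exp x - 1 := sub_pos.2 (Real.one_lt_exp_iff.2 hx)
  exact (by positivity : 0 < x ^ 2 / (Real.exp x - 1)).trans_le (sq_div_le_debye_integral hx)

lemma hasDerivAt_debye_integral {x : ℝ} (hx : 0 < x) :
    HasDerivAt (fun y => ∫ t in (0 : ℝ)..y, t / (Real.exp t - 1)) (x / (Real.exp x - 1)) x := by
  refine intervalIntegral.integral_hasDerivAt_right (debye_intervalIntegrable hx.le)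
    debye_integrand_measurable.stronglyMeasurable.stronglyMeasurableAtFilter ?_
  exact continuousAt_id.div (by fun_prop) (sub_pos.2 (Real.one_lt_exp_iff.2 hx)).ne'

lemma hasDerivAt_div_sqrt_debye_integral {x : ℝ} (hx : 0 < x) :
    HasDerivAt (fun y => y / √(∫ t in (0 : ℝ)..y, t / (Real.exp t - 1)))
      ((1 - x ^ 2 / (Real.exp x - 1) / (2 * ∫ t in (0 : ℝ)..x, t / (Real.exp t - 1))) /
        √(∫ t in (0 : ℝ)..x, t / (Real.exp t - 1))) x := by
  have hD := debye_integral_pos hx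
  have h := (hasDerivAt_id x).div ((hasDerivAt_debye_integral hx).sqrt hD.ne')
    (Real.sqrt_pos.2 hD).ne'
  refine h.congr_deriv ?_
  have hE : 0 < Real.exp x - 1 := sub_pos.2 (Real.one_lt_exp_iff.2 hx)
  set D := ∫ t in (0 : ℝ)..x, t / (Real.exp t - 1)
  have hs : 0 < √D := Real.sqrt_pos.2 hD
  have hsq : D = √D ^ 2 := (Real.sq_sqrt hD.le).symm
  generalize √D = s at *
  rw [hsq]
  simp only [id]
  field_simp

lemma deriv_div_sqrt_debye_integral_pos {x : ℝ} (hx : 0 < x) :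
    0 < (1 - x ^ 2 / (Real.exp x - 1) / (2 * ∫ t in (0 : ℝ)..x, t / (Real.exp t - 1))) /
        √(∫ t in (0 : ℝ)..x, t / (Real.exp t - 1)) := by
  have hD := debye_integral_pos hx
  refine div_pos (sub_pos.2 ?_) (Real.sqrt_pos.2 hD)
  rw [div_lt_one (by positivity)]
  linarith [sq_div_le_debye_integral hx]

lemma strictMonoOn_div_sqrt_debye_integral :
    StrictMonoOn (fun y => y / √(∫ t in (0 : ℝ)..y, t / (Real.exp t - 1))) (Set.Ioi 0) := by
  refine strictMonoOn_of_deriv_pos (convex_Ioi 0)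
    (fun x hx => (hasDerivAt_div_sqrt_debye_integral hx).continuousAt.continuousWithinAt)
    fun x hx => ?_
  rw [interior_Ioi] at hx
  rw [(hasDerivAt_div_sqrt_debye_integral hx).deriv]
  exact deriv_div_sqrt_debye_integral_pos hx

section ImplicitFunction

variable {v : ℝ → ℝ}

lemma sq_div_two_lt_exp_sub_one {u x : ℝ} (hx : 0 < x)
    (h : u ^ 2 = x ^ 2 / ∫ t in (0 : ℝ)..x, t / (Real.exp t - 1)) :
    0 < Real.exp x - 1 - u ^ 2 / 2 := by
  have hD := debye_integral_pos hx
  have hE : 0 < Real.exp x - 1 := sub_pos.2 (Real.one_lt_exp_iff.2 hx)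
  have h1 := sq_div_le_debye_integral hx
  rw [div_le_comm₀ hE hD, ← h] at h1
  linarith

lemma hasDerivAt_of_sq_eq_div_debye_integral
    (hv : ∀ u : ℝ, 0 < u → 0 < v u ∧
      u ^ 2 = (v u) ^ 2 / ∫ t in (0 : ℝ)..(v u), t / (Real.exp t - 1)) {u : ℝ} (hu : 0 < u) :
    HasDerivAt v
      (v u / u * (Real.exp (v u) - 1) / (Real.exp (v u) - 1 - u ^ 2 / 2)) u := by
  have hinv : ∀ w, 0 < w → v w / √(∫ t in (0 : ℝ)..(v w), t / (Real.exp t - 1)) = w := by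
    intro w hw
    nth_rewrite 1 [← Real.sqrt_sq (hv w hw).1.le]
    rw [← Real.sqrt_div (sq_nonneg _), ← (hv w hw).2, Real.sqrt_sq hw.le]
  have hcont : ContinuousAt v u :=
    continuousAt_of_strictMonoOn_leftInverse strictMonoOn_div_sqrt_debye_integral
      (fun x hx => div_pos hx (Real.sqrt_pos.2 (debye_integral_pos hx)))
      (fun w hw => (hv w hw).1) hinv hu
  have hx := (hv u hu).1
  have h := (hasDerivAt_div_sqrt_debye_integral hx).of_local_left_inverse hcont
    (deriv_div_sqrt_debye_integral_pos hx).ne'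
    (Filter.eventually_of_mem (Ioi_mem_nhds hu) hinv)
  refine h.congr_deriv ?_
  have hQ := sq_div_two_lt_exp_sub_one hx (hv u hu).2
  have hE : 0 < Real.exp (v u) - 1 := sub_pos.2 (Real.one_lt_exp_iff.2 hx)
  have hD := debye_integral_pos hx
  have hi := hinv u hu
  set D := ∫ t in (0 : ℝ)..(v u), t / (Real.exp t - 1)
  have hs : 0 < √D := Real.sqrt_pos.2 hD
  have hsD : √D = v u / u := by
    rw [div_eq_iff hs.ne'] at hi
    rw [eq_div_iff hu.ne', mul_comm]
    exact hi.symm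
  have hDD : D = (v u / u) ^ 2 := by rw [← hsD, Real.sq_sqrt hD.le]
  rw [hsD, hDD]
  generalize Real.exp (v u) - 1 = E at *
  have hkey : 1 - v u ^ 2 / E / (2 * (v u / u) ^ 2) = (E - u ^ 2 / 2) / E := by
    field_simp
  rw [hkey, inv_div, div_div_eq_mul_div]

lemma hasDerivAt_log_one_sub_exp_neg {v' u : ℝ} (hx : 0 < v u) (hv' : HasDerivAt v v' u) :
    HasDerivAt (fun w => Real.log (1 - Real.exp (-(v w)))) (v' / (Real.exp (v u) - 1)) u := by
  have hE : 0 < Real.exp (v u) - 1 := sub_pos.2 (Real.one_lt_exp_iff.2 hx)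
  have hN : 0 < 1 - Real.exp (-(v u)) :=
    sub_pos.2 (Real.exp_lt_one_iff.2 (neg_lt_zero.2 hx))
  refine ((hv'.neg.exp.const_sub 1).log hN.ne').congr_deriv ?_
  simp only [Pi.neg_apply]
  have hprod : Real.exp (-(v u)) * Real.exp (v u) = 1 := by rw [← Real.exp_add]; simp
  rw [div_eq_div_iff hN.ne' hE.ne']
  linear_combination v' * hprod

end ImplicitFunction

/-- If `v = v(u) > 0` is determined by `u² = v² / ∫₀^v t/(eᵗ-1) dt`, and
`g(u) = 2v/u - u log(1 - e^{-v})`, then `g` is twice differentiable on `(0,∞)` with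
`g′(u) = -log(1 - e^{-v(u)})` and `g″(u) = -(v/u)/(e^v - 1 - u²/2)`. -/
theorem stmt_8 (v g : ℝ → ℝ)
    (hv : ∀ u : ℝ, 0 < u → 0 < v u ∧
      u ^ 2 = (v u) ^ 2 / ∫ t in (0 : ℝ)..(v u), t / (Real.exp t - 1))
    (hg : ∀ u : ℝ, 0 < u →
      g u = 2 * v u / u - u * Real.log (1 - Real.exp (-(v u)))) :
    ∀ u : ℝ, 0 < u →
      HasDerivAt g (-Real.log (1 - Real.exp (-(v u)))) u ∧
      HasDerivAt (deriv g) (-(v u / u) / (Real.exp (v u) - 1 - u ^ 2 / 2)) u := by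
  have hfirst : ∀ u : ℝ, 0 < u → HasDerivAt g (-Real.log (1 - Real.exp (-(v u)))) u := by
    intro u hu
    have hx := (hv u hu).1
    have hv' := hasDerivAt_of_sq_eq_div_debye_integral hv hu
    have hQ := sq_div_two_lt_exp_sub_one hx (hv u hu).2
    have hE : 0 < Real.exp (v u) - 1 := sub_pos.2 (Real.one_lt_exp_iff.2 hx)
    have h := ((hv'.const_mul 2).div (hasDerivAt_id u) hu.ne').sub
      ((hasDerivAt_id u).mul (hasDerivAt_log_one_sub_exp_neg hx hv'))
    refine (h.congr_of_eventuallyEq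
      (Filter.eventually_of_mem (Ioi_mem_nhds hu) hg)).congr_deriv ?_
    simp only [id]
    generalize Real.log (1 - Real.exp (-(v u))) = L
    generalize Real.exp (v u) - 1 = E at *
    obtain ⟨Q, rfl⟩ : ∃ Q, E = Q + u ^ 2 / 2 := ⟨E - u ^ 2 / 2, by ring⟩
    rw [add_sub_cancel_right] at *
    field_simp
    ring
  intro u hu
  refine ⟨hfirst u hu, ?_⟩
  have hx := (hv u hu).1
  have hE : 0 < Real.exp (v u) - 1 := sub_pos.2 (Real.one_lt_exp_iff.2 hx)
  refine ((hasDerivAt_log_one_sub_exp_neg hx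
    (hasDerivAt_of_sq_eq_div_debye_integral hv hu)).neg.congr_of_eventuallyEq
      (Filter.eventually_of_mem (Ioi_mem_nhds hu) fun w hw => (hfirst w hw).deriv)).congr_deriv ?_
  rw [div_right_comm, mul_div_cancel_right₀ _ hE.ne', neg_div]
end

section
/- Fix λ > 0. For t > 0 let v = v(t) > 0 be determined by t² = v² / ∫₀^v s/(e^s − 1) ds, let g(t) = 2v/t − t·log(1 − e^{−v}), and define ψ(t) = g(t)/t − λ/t². Then ψ′(t) = 2(λ − v(t))/t³ for all t > 0; consequently, with t₀ = λ / (∫₀^λ s/(e^s − 1) ds)^{1/2}, one has ψ′(t₀) = 0, ψ is strictly increasing on (0, t₀] and strictly decreasing on [t₀, ∞). -/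
open Real Set Filter Topology MeasureTheory

/-- The Debye-type integral `∫₀ᵘ s / (eˢ - 1) ds`. -/
noncomputable def debyeIntegral (u : ℝ) : ℝ :=
  ∫ s in (0 : ℝ)..u, s / (Real.exp s - 1)

/-- The map `u ↦ u / √(∫₀ᵘ s / (eˢ - 1) ds)`. -/
noncomputable def debyeRatio (u : ℝ) : ℝ :=
  u / Real.sqrt (debyeIntegral u)

lemma exp_sub_one_pos_s9 {s : ℝ} (hs : 0 < s) : 0 < Real.exp s - 1 := by
  have := Real.one_lt_exp_iff.2 hs
  linarith

lemma div_exp_sub_one_le_of_le {s u : ℝ} (hs : 0 < s) (hsu : s ≤ u) :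
    u / (Real.exp u - 1) ≤ s / (Real.exp s - 1) := by
  have hu : 0 < u := hs.trans_le hsu
  rw [div_le_div_iff₀ (exp_sub_one_pos_s9 hu) (exp_sub_one_pos_s9 hs)]
  have h := convexOn_exp.2 (mem_univ (0 : ℝ)) (mem_univ u)
    (sub_nonneg.2 ((div_le_one hu).2 hsu)) (div_pos hs hu).le (by ring)
  simp only [smul_eq_mul, mul_zero, zero_add, Real.exp_zero, mul_one,
    div_mul_cancel₀ s hu.ne'] at h
  have h' := mul_le_mul_of_nonneg_left h hu.le
  have e : u * (1 - s / u + s / u * Real.exp u) = u - s + s * Real.exp u := by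
    field_simp
  linarith

lemma measurable_div_exp_sub_one : Measurable fun s : ℝ => s / (Real.exp s - 1) :=
  measurable_id.div (Real.measurable_exp.sub_const 1)

lemma intervalIntegrable_div_exp_sub_one_s9 {u : ℝ} (hu : 0 < u) :
    IntervalIntegrable (fun s : ℝ => s / (Real.exp s - 1)) volume 0 u := by
  rw [intervalIntegrable_iff_integrableOn_Ioc_of_le hu.le]
  refine Measure.integrableOn_of_bounded (M := 1) (by simp)
    measurable_div_exp_sub_one.aestronglyMeasurable ?_
  filter_upwards [ae_restrict_mem measurableSet_Ioc] with s hs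
  have hp := exp_sub_one_pos_s9 hs.1
  rw [Real.norm_of_nonneg (div_pos hs.1 hp).le, div_le_one hp]
  linarith [Real.add_one_le_exp s]

lemma mul_div_exp_sub_one_le_debyeIntegral {u : ℝ} (hu : 0 < u) :
    u * (u / (Real.exp u - 1)) ≤ debyeIntegral u := by
  have h := intervalIntegral.integral_mono_on_of_le_Ioo hu.le
    (intervalIntegrable_const (c := u / (Real.exp u - 1)))
    (intervalIntegrable_div_exp_sub_one_s9 hu)
    fun s hs => div_exp_sub_one_le_of_le hs.1 hs.2.le
  simpa [debyeIntegral, mul_div_assoc] using h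

lemma debyeIntegral_pos {u : ℝ} (hu : 0 < u) : 0 < debyeIntegral u :=
  (mul_pos hu (div_pos hu (exp_sub_one_pos_s9 hu))).trans_le
    (mul_div_exp_sub_one_le_debyeIntegral hu)

lemma hasDerivAt_debyeIntegral {u : ℝ} (hu : 0 < u) :
    HasDerivAt debyeIntegral (u / (Real.exp u - 1)) u := by
  refine intervalIntegral.integral_hasDerivAt_right (intervalIntegrable_div_exp_sub_one_s9 hu)
    measurable_div_exp_sub_one.stronglyMeasurable.stronglyMeasurableAtFilter ?_
  exact continuousAt_id.div (Real.continuous_exp.continuousAt.sub continuousAt_const)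
    (exp_sub_one_pos_s9 hu).ne'

lemma debyeRatio_pos {u : ℝ} (hu : 0 < u) : 0 < debyeRatio u :=
  div_pos hu (Real.sqrt_pos.2 (debyeIntegral_pos hu))

lemma debyeRatio_sq {u : ℝ} (hu : 0 < u) : debyeRatio u ^ 2 = u ^ 2 / debyeIntegral u := by
  rw [debyeRatio, div_pow, Real.sq_sqrt (debyeIntegral_pos hu).le]

lemma two_mul_debyeIntegral_sub_pos {u : ℝ} (hu : 0 < u) :
    0 < 2 * debyeIntegral u - u * (u / (Real.exp u - 1)) := by
  linarith [mul_div_exp_sub_one_le_debyeIntegral hu, debyeIntegral_pos hu]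

lemma hasDerivAt_debyeRatio {u : ℝ} (hu : 0 < u) :
    HasDerivAt debyeRatio
      ((2 * debyeIntegral u - u * (u / (Real.exp u - 1))) / (2 * √(debyeIntegral u) ^ 3)) u := by
  have hI := debyeIntegral_pos hu
  have hr := Real.sqrt_pos.2 hI
  have h := (hasDerivAt_id u).div ((hasDerivAt_debyeIntegral hu).sqrt hI.ne') hr.ne'
  refine h.congr_deriv ?_
  have e := Real.sq_sqrt hI.le
  have hp := exp_sub_one_pos_s9 hu
  set r := √(debyeIntegral u)
  rw [← e]
  simp only [id]
  field_simp

lemma strictMonoOn_debyeRatio : StrictMonoOn debyeRatio (Ioi 0) := by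
  refine strictMonoOn_of_deriv_pos (convex_Ioi 0)
    (fun u hu => (hasDerivAt_debyeRatio hu).continuousAt.continuousWithinAt) fun u hu => ?_
  rw [interior_Ioi] at hu
  rw [(hasDerivAt_debyeRatio hu).deriv]
  have := Real.sqrt_pos.2 (debyeIntegral_pos hu)
  exact div_pos (two_mul_debyeIntegral_sub_pos hu) (by positivity)

lemma strictMonoOn_of_debyeRatio_rightInverse {v : ℝ → ℝ} (hpos : ∀ t, 0 < t → 0 < v t)
    (hinv : ∀ t, 0 < t → debyeRatio (v t) = t) :
    StrictMonoOn v (Ioi 0) := by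
  intro a ha b hb hab
  rw [← strictMonoOn_debyeRatio.lt_iff_lt (hpos a ha) (hpos b hb), hinv a ha, hinv b hb]
  exact hab

lemma leftInverse_of_debyeRatio_rightInverse {v : ℝ → ℝ} (hpos : ∀ t, 0 < t → 0 < v t)
    (hinv : ∀ t, 0 < t → debyeRatio (v t) = t) {u : ℝ} (hu : 0 < u) :
    v (debyeRatio u) = u :=
  strictMonoOn_debyeRatio.injOn (hpos _ (debyeRatio_pos hu)) hu (hinv _ (debyeRatio_pos hu))

lemma hasDerivAt_of_debyeRatio_rightInverse {v : ℝ → ℝ} (hpos : ∀ t, 0 < t → 0 < v t)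
    (hinv : ∀ t, 0 < t → debyeRatio (v t) = t) {t : ℝ} (ht : 0 < t) :
    HasDerivAt v ((2 * debyeIntegral (v t) - v t * (v t / (Real.exp (v t) - 1))) /
      (2 * √(debyeIntegral (v t)) ^ 3))⁻¹ t := by
  have hu := hpos t ht
  have hr := Real.sqrt_pos.2 (debyeIntegral_pos hu)
  have himage : v '' Ioi 0 ∈ 𝓝 (v t) := by
    filter_upwards [Ioi_mem_nhds hu] with u hu'
    exact ⟨debyeRatio u, debyeRatio_pos hu', leftInverse_of_debyeRatio_rightInverse hpos hinv hu'⟩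
  have hcont : ContinuousAt v t :=
    (strictMonoOn_of_debyeRatio_rightInverse hpos hinv).continuousAt_of_image_mem_nhds
      (Ioi_mem_nhds ht) himage
  refine (hasDerivAt_debyeRatio hu).of_local_left_inverse hcont
    (div_pos (two_mul_debyeIntegral_sub_pos hu) (by positivity)).ne' ?_
  filter_upwards [Ioi_mem_nhds ht] with s hs using hinv s hs


/-- For `λ > 0`, with `v(t)` determined by `t² = v² / ∫₀^v s/(eˢ-1) ds`,
`g(t) = 2v/t - t log(1 - e^{-v})` and `ψ(t) = g(t)/t - λ/t²`, one has
`ψ′(t) = 2(λ - v(t))/t³` for all `t > 0`; consequently, with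
`t₀ = λ/(∫₀^λ s/(eˢ-1) ds)^{1/2}`, `ψ′(t₀) = 0`, `ψ` is strictly increasing
on `(0, t₀]` and strictly decreasing on `[t₀, ∞)`. -/
theorem stmt_9 (lam : ℝ) (hlam : 0 < lam) (v g ψ : ℝ → ℝ)
    (hv : ∀ t : ℝ, 0 < t → 0 < v t ∧
      t ^ 2 = (v t) ^ 2 / ∫ s in (0 : ℝ)..(v t), s / (Real.exp s - 1))
    (hg : ∀ t : ℝ, 0 < t →
      g t = 2 * v t / t - t * Real.log (1 - Real.exp (-(v t))))
    (hψ : ∀ t : ℝ, 0 < t → ψ t = g t / t - lam / t ^ 2)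
    (t₀ : ℝ)
    (ht₀ : t₀ = lam / Real.sqrt (∫ s in (0 : ℝ)..lam, s / (Real.exp s - 1))) :
    (∀ t : ℝ, 0 < t → HasDerivAt ψ (2 * (lam - v t) / t ^ 3) t) ∧
    deriv ψ t₀ = 0 ∧
    StrictMonoOn ψ (Set.Ioc (0 : ℝ) t₀) ∧
    StrictAntiOn ψ (Set.Ici t₀) := by
  have hpos : ∀ t, 0 < t → 0 < v t := fun t ht => (hv t ht).1
  have hinv : ∀ t, 0 < t → debyeRatio (v t) = t := by
    intro t ht
    refine (pow_left_inj₀ (debyeRatio_pos (hpos t ht)).le ht.le two_ne_zero).1 ?_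
    rw [debyeRatio_sq (hpos t ht)]
    exact (hv t ht).2.symm
  have ht₀' : t₀ = debyeRatio lam := ht₀
  have ht₀pos : 0 < t₀ := ht₀' ▸ debyeRatio_pos hlam
  have hvt₀ : v t₀ = lam := ht₀' ▸ leftInverse_of_debyeRatio_rightInverse hpos hinv hlam
  have hmono := strictMonoOn_of_debyeRatio_rightInverse hpos hinv
  have hderiv : ∀ t : ℝ, 0 < t → HasDerivAt ψ (2 * (lam - v t) / t ^ 3) t := by
    intro t ht
    have hu := hpos t ht
    have hE := exp_sub_one_pos_s9 hu
    have hlog : 0 < 1 - Real.exp (-(v t)) := by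
      have := Real.exp_lt_one_iff.2 (neg_lt_zero.2 hu)
      linarith
    have hr := Real.sqrt_pos.2 (debyeIntegral_pos hu)
    have hd := hasDerivAt_of_debyeRatio_rightInverse hpos hinv ht
    have hψ' : ψ =ᶠ[𝓝 t] fun t =>
        (2 * v t - lam) / t ^ 2 - Real.log (1 - Real.exp (-(v t))) := by
      filter_upwards [Ioi_mem_nhds ht] with s hs
      have hs' : s ≠ 0 := ne_of_gt hs
      rw [hψ s hs, hg s hs]
      field_simp
      ring
    refine HasDerivAt.congr_of_eventuallyEq ?_ hψ'
    refine ((((hd.const_mul 2).sub_const lam).fun_div (hasDerivAt_pow 2 t) (by positivity)).fun_sub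
      ((hd.fun_neg.exp.const_sub 1).log hlog.ne')).congr_deriv ?_
    have htr : v t = t * √(debyeIntegral (v t)) := by
      have := hinv t ht
      rwa [debyeRatio, div_eq_iff hr.ne'] at this
    have hD := two_mul_debyeIntegral_sub_pos hu
    have hexp : Real.exp (-(v t)) / (1 - Real.exp (-(v t))) = 1 / (Real.exp (v t) - 1) := by
      rw [div_eq_div_iff hlog.ne' hE.ne', mul_sub, ← Real.exp_add]
      simp
    have hsq := Real.sq_sqrt (debyeIntegral_pos hu).le
    set r := √(debyeIntegral (v t))
    set E := Real.exp (v t) - 1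
    set d := ((2 * debyeIntegral (v t) - v t * (v t / E)) / (2 * r ^ 3))⁻¹ with hd_def
    have hd_eq : d * (2 - t ^ 2 / E) = 2 * r := by
      have h : d * (2 * debyeIntegral (v t) - v t * (v t / E)) = 2 * r ^ 3 := by
        rw [hd_def, inv_div, div_mul_cancel₀ _ hD.ne']
      rw [← hsq, htr] at h
      refine mul_left_cancel₀ (pow_pos hr 2).ne' ?_
      linear_combination h
    have hlog_eq : -(Real.exp (-(v t)) * -d) / (1 - Real.exp (-(v t))) = d / E := by
      linear_combination d * hexp
    rw [hlog_eq]
    have hE' : d / E = (2 * d - 2 * r) / t ^ 2 := by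
      rw [eq_div_iff (by positivity)]
      linear_combination -hd_eq
    rw [hE']
    field_simp
    linear_combination (-2 * t) * htr
  refine ⟨hderiv, ?_, ?_, ?_⟩
  · rw [(hderiv t₀ ht₀pos).deriv, hvt₀]
    simp
  · refine strictMonoOn_of_deriv_pos (convex_Ioc 0 t₀)
      (fun t ht => (hderiv t ht.1).continuousAt.continuousWithinAt) fun t ht => ?_
    rw [interior_Ioc] at ht
    rw [(hderiv t ht.1).deriv]
    have := hmono ht.1 ht₀pos ht.2
    have := pow_pos ht.1 3
    exact div_pos (by linarith) this
  · refine strictAntiOn_of_deriv_neg (convex_Ici t₀)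
      (fun t ht => (hderiv t (ht₀pos.trans_le ht)).continuousAt.continuousWithinAt) fun t ht => ?_
    rw [interior_Ici] at ht
    have htpos : 0 < t := ht₀pos.trans ht
    rw [(hderiv t htpos).deriv]
    have := hmono ht₀pos htpos ht
    have := pow_pos htpos 3
    exact div_neg_of_neg_of_pos (by linarith) this
end
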